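/- arXiv:2105.13167 — 2 statements merged into one kernel-verified Lean document; each statement's English description precedes it below -/
import Mathlib

section
/- In the setup of two homogeneous compressed Gorenstein ideals I1, I2 ⊆ q^2 in the power series ring in e ≥ 3 variables with R = Q/(I1 ∩ I2) compressed of type 2, setting R' = Q/(I1 + I2) with socle degree s' and initial degree t', one has 2 ≤ t' ≤ s' + 1 ≤ t ≤ s' + 2, where t is the initial degree of I1 ∩ I2; moreover h_{R'}(i) = max{0, h_{R1}(i) + h_{R2}(i) − h_Q(i)} for all i ≥ 0. -/
open MvPolynomial

/-- The ideal generated by the variables (the graded maximal ideal `q`). -/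
noncomputable def qIdeal (k : Type*) [Field k] (e : ℕ) : Ideal (MvPolynomial (Fin e) k) :=
  Ideal.span (Set.range X)

/-- The Hilbert function of `Q/J`: `h(i) = dim_k (q^i + J)/(q^{i+1} + J)`. -/
noncomputable def hilb (k : Type*) [Field k] (e : ℕ)
    (J : Ideal (MvPolynomial (Fin e) k)) (i : ℕ) : ℕ :=
  Module.finrank k
    (((qIdeal k e ^ i ⊔ J).map (Ideal.Quotient.mk (qIdeal k e ^ (i + 1) ⊔ J))).restrictScalars k)

/-- An ideal is homogeneous if it is generated by homogeneous polynomials. -/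
def IsHomogeneousIdeal (k : Type*) [Field k] (e : ℕ)
    (J : Ideal (MvPolynomial (Fin e) k)) : Prop :=
  ∃ S : Set (MvPolynomial (Fin e) k),
    (∀ p ∈ S, ∃ n, MvPolynomial.IsHomogeneous p n) ∧ J = Ideal.span S

/-- Hilbert function of the ambient ring: `h_Q(i) = binom(e−1+i, e−1)`. -/
def hQ (e i : ℕ) : ℕ := Nat.choose (e - 1 + i) (e - 1)

/-- `h_Q(σ − i)`, interpreted as `0` for `i > σ`. -/
def hQat (e σ i : ℕ) : ℕ := if i ≤ σ then hQ e (σ - i) else 0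

/-- `Q/J` has type 1 (is artinian Gorenstein): the socle `(J : q)/J` is spanned
by one nonzero element. -/
def HasTypeOne (k : Type*) [Field k] (e : ℕ) (J : Ideal (MvPolynomial (Fin e) k)) : Prop :=
  ∃ x, x ∉ J ∧ J.colon (qIdeal k e) = J ⊔ Ideal.span {x}

/-- `Q/J` has type 2: the socle `(J : q)/J` is spanned by two elements whose
cosets are linearly independent over `k`. -/
def HasTypeTwo (k : Type*) [Field k] (e : ℕ) (J : Ideal (MvPolynomial (Fin e) k)) : Prop :=
  ∃ x y, J.colon (qIdeal k e) = J ⊔ Ideal.span {x, y} ∧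
    ∀ a b : MvPolynomial (Fin e) k, a * x + b * y ∈ J →
      a ∈ qIdeal k e ∧ b ∈ qIdeal k e

/-- `σ` is the socle degree of `Q/J`. -/
def SocDeg (k : Type*) [Field k] (e : ℕ) (J : Ideal (MvPolynomial (Fin e) k)) (σ : ℕ) : Prop :=
  ¬ qIdeal k e ^ σ ≤ J ∧ qIdeal k e ^ (σ + 1) ≤ J

/-- `τ` is the initial degree of `J`. -/
def IniDeg (k : Type*) [Field k] (e : ℕ) (J : Ideal (MvPolynomial (Fin e) k)) (τ : ℕ) : Prop :=
  J ≤ qIdeal k e ^ τ ∧ ¬ J ≤ qIdeal k e ^ (τ + 1)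

/-- `Q/J` is a compressed Gorenstein ring of socle degree `σ`. -/
def CompressedGor (k : Type*) [Field k] (e : ℕ) (J : Ideal (MvPolynomial (Fin e) k)) (σ : ℕ) : Prop :=
  ∀ i, hilb k e J i = min (hQ e i) (hQat e σ i)

section Helpers

variable {k : Type*} [Field k] {e : ℕ}

/-- Closed under taking homogeneous components. -/
def HComp (J : Ideal (MvPolynomial (Fin e) k)) : Prop :=
  ∀ f ∈ J, ∀ n, homogeneousComponent n f ∈ J

lemma IsHomogeneousIdeal.hcomp {J : Ideal (MvPolynomial (Fin e) k)}
    (h : IsHomogeneousIdeal k e J) : HComp J := by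
  letI : GradedAlgebra (homogeneousSubmodule (Fin e) k) := MvPolynomial.gradedAlgebra
  obtain ⟨S, hS, rfl⟩ := h
  intro f hf n
  exact homogeneousComponent_mem_of_mem (Ideal.homogeneous_span _ S fun x hx => hS x hx) hf n

lemma HComp.inf {I J : Ideal (MvPolynomial (Fin e) k)} (hI : HComp I) (hJ : HComp J) :
    HComp (I ⊓ J) := fun f hf n => ⟨hI f hf.1 n, hJ f hf.2 n⟩

lemma HComp.sup {I J : Ideal (MvPolynomial (Fin e) k)} (hI : HComp I) (hJ : HComp J) :
    HComp (I ⊔ J) := by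
  intro f hf n
  obtain ⟨a, ha, b, hb, rfl⟩ := Submodule.mem_sup.1 hf
  rw [map_add]
  exact Submodule.add_mem_sup (hI a ha n) (hJ b hb n)

lemma mem_q_pow (n : ℕ) (p : MvPolynomial (Fin e) k) :
    p ∈ qIdeal k e ^ n ↔ ∀ x, Finsupp.degree x < n → p.coeff x = 0 :=
  mem_pow_idealOfVars_iff' n p

lemma hc_eq_zero_of_mem {n i : ℕ} (h : i < n) {p : MvPolynomial (Fin e) k}
    (hp : p ∈ qIdeal k e ^ n) : homogeneousComponent i p = 0 := by
  ext d
  rw [coeff_homogeneousComponent]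
  split_ifs with hd
  · simpa using (mem_q_pow n p).1 hp d (by omega)
  · simp

lemma sub_hc_mem {n : ℕ} {p : MvPolynomial (Fin e) k} (hp : p ∈ qIdeal k e ^ n) :
    p - homogeneousComponent n p ∈ qIdeal k e ^ (n + 1) := by
  rw [mem_q_pow] at hp ⊢
  intro x hx
  rw [coeff_sub, coeff_homogeneousComponent]
  split_ifs with hd
  · simp
  · simp [hp x (by omega)]

lemma homog_mem {n : ℕ} {p : MvPolynomial (Fin e) k} (hp : p.IsHomogeneous n) :
    p ∈ qIdeal k e ^ n := by
  rw [mem_q_pow]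
  intro x hx
  by_contra h
  have := hp.coeff_eq_zero (d := x) (by omega)
  exact h this

/-- Degree `i` part of an ideal. -/
noncomputable def Jd (J : Ideal (MvPolynomial (Fin e) k)) (i : ℕ) :
    Submodule k (MvPolynomial (Fin e) k) :=
  J.restrictScalars k ⊓ homogeneousSubmodule (Fin e) k i

instance homFin (i : ℕ) : FiniteDimensional k (homogeneousSubmodule (Fin e) k i) :=
  Module.Finite.iff_fg.2 (homogeneousSubmodule_fg _ _ i)

instance jdFin (J : Ideal (MvPolynomial (Fin e) k)) (i : ℕ) : FiniteDimensional k (Jd J i) :=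
  Submodule.finiteDimensional_of_le (inf_le_right : Jd J i ≤ homogeneousSubmodule (Fin e) k i)

lemma finrank_homog (he : 1 ≤ e) (i : ℕ) :
    Module.finrank k (homogeneousSubmodule (Fin e) k i) = hQ e i := by
  have h1 : homogeneousSubmodule (Fin e) k i = restrictSupport k {d | d.degree = i} :=
    homogeneousSubmodule_eq_finsupp_supported _ _ i
  rw [h1, Module.finrank_eq_nat_card_basis (basisRestrictSupport k {d : Fin e →₀ ℕ | d.degree = i})]
  have h2 : {d : Fin e →₀ ℕ | d.degree = i} =
      ((Finset.univ : Finset (Fin e)).finsuppAntidiag i : Set (Fin e →₀ ℕ)) := by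
    ext d
    simp [Finset.mem_finsuppAntidiag, Finsupp.degree_eq_sum]
  rw [h2, Nat.card_coe_set_eq, Set.ncard_coe_finset, Finset.card_finsuppAntidiag_nat_eq_choose]
  simp only [Finset.card_univ, Fintype.card_fin, hQ]
  rw [show e + i - 1 = e - 1 + i by omega, Nat.choose_symm_add]

lemma hilb_add (he : 1 ≤ e) {J : Ideal (MvPolynomial (Fin e) k)} (hJ : HComp J) (i : ℕ) :
    hilb k e J i + Module.finrank k (Jd J i) = hQ e i := by
  rw [← finrank_homog (k := k) he i]
  let H := homogeneousSubmodule (Fin e) k i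
  let K := qIdeal k e ^ (i + 1) ⊔ J
  let φ : H →ₗ[k] (MvPolynomial (Fin e) k ⧸ K) :=
    (Ideal.Quotient.mkₐ k K).toLinearMap ∘ₗ H.subtype
  have hφ : ∀ x : H, φ x = Ideal.Quotient.mk K x := fun x => rfl
  have hr : LinearMap.range φ =
      ((qIdeal k e ^ i ⊔ J).map (Ideal.Quotient.mk K)).restrictScalars k := by
    ext y
    constructor
    · rintro ⟨x, rfl⟩
      rw [hφ]
      exact Ideal.mem_map_of_mem _ (Ideal.mem_sup_left (homog_mem x.2))
    · intro hy
      obtain ⟨f, hf, rfl⟩ := (Ideal.mem_map_iff_of_surjective _ Ideal.Quotient.mk_surjective).1 hy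
      obtain ⟨a, ha, b, hb, rfl⟩ := Submodule.mem_sup.1 hf
      refine ⟨⟨homogeneousComponent i a, homogeneousComponent_mem i a⟩, ?_⟩
      rw [hφ]
      apply Ideal.Quotient.eq.2
      have h3 := sub_hc_mem ha
      have h4 : homogeneousComponent i a - (a + b) = -(a - homogeneousComponent i a) + -b := by ring
      rw [h4]
      exact Submodule.add_mem_sup (neg_mem h3) (neg_mem hb)
  have hk : LinearMap.ker φ = (Jd J i).comap H.subtype := by
    ext x
    rw [LinearMap.mem_ker, hφ, Ideal.Quotient.eq_zero_iff_mem, Submodule.mem_comap]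
    constructor
    · intro hx
      refine ⟨?_, x.2⟩
      obtain ⟨a, ha, b, hb, hab⟩ := Submodule.mem_sup.1 hx
      have h5 : homogeneousComponent i (x : MvPolynomial (Fin e) k) = x :=
        homogeneousComponent_eq_self x.2
      have h6 := hc_eq_zero_of_mem (Nat.lt_succ_self i) ha
      rw [← hab, map_add, h6, zero_add, hab] at h5
      change (x : MvPolynomial (Fin e) k) ∈ J
      rw [← h5]
      exact hJ b hb i
    · intro hx
      exact Ideal.mem_sup_right hx.1
  have h7 := LinearMap.finrank_range_add_finrank_ker φ
  rw [hr, hk] at h7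
  have h8 : Module.finrank k ((Jd J i).comap H.subtype) = Module.finrank k (Jd J i) :=
    (Submodule.comapSubtypeEquivOfLe (inf_le_right : Jd J i ≤ H)).finrank_eq
  rw [h8] at h7
  exact h7

lemma hilb_mv (he : 1 ≤ e) {I J : Ideal (MvPolynomial (Fin e) k)} (hI : HComp I) (hJ : HComp J)
    (i : ℕ) : hilb k e (I ⊓ J) i + hilb k e (I ⊔ J) i = hilb k e I i + hilb k e J i := by
  have h1 := hilb_add he hI i
  have h2 := hilb_add he hJ i
  have h3 := hilb_add he (hI.inf hJ) i
  have h4 := hilb_add he (hI.sup hJ) i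
  have h5 := Submodule.finrank_sup_add_finrank_inf_eq (Jd I i) (Jd J i)
  have h6 : Jd I i ⊓ Jd J i = Jd (I ⊓ J) i := by
    ext x
    simp only [Jd, Submodule.mem_inf, Submodule.restrictScalars_mem]
    tauto
  have h7 : Jd I i ⊔ Jd J i = Jd (I ⊔ J) i := by
    apply le_antisymm
    · refine sup_le ?_ ?_
      · exact fun x hx => ⟨Ideal.mem_sup_left hx.1, hx.2⟩
      · exact fun x hx => ⟨Ideal.mem_sup_right hx.1, hx.2⟩
    · rintro x ⟨hx, hx'⟩
      obtain ⟨a, ha, b, hb, hab⟩ := Submodule.mem_sup.1 hx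
      have h5 : homogeneousComponent i x = x := homogeneousComponent_eq_self hx'
      rw [← h5, ← hab, map_add]
      exact Submodule.add_mem_sup ⟨hI a ha i, homogeneousComponent_mem i a⟩
        ⟨hJ b hb i, homogeneousComponent_mem i b⟩
  rw [h6, h7] at h5
  omega

lemma hilb_zero_iff (he : 1 ≤ e) {J : Ideal (MvPolynomial (Fin e) k)} (hJ : HComp J) (i : ℕ) :
    hilb k e J i = 0 ↔ qIdeal k e ^ i ≤ J := by
  have h1 := hilb_add he hJ i
  have h2 := finrank_homog (k := k) he i
  constructor
  · intro h
    have h3 : Jd J i = homogeneousSubmodule (Fin e) k i :=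
      Submodule.eq_of_le_of_finrank_eq inf_le_right (by omega)
    have h4 : qIdeal k e ^ i = _ := pow_idealOfVars_eq_span i
    rw [h4, Ideal.span_le]
    rintro _ ⟨d, hd, rfl⟩
    have h5 : monomial d (1 : k) ∈ homogeneousSubmodule (Fin e) k i :=
      isHomogeneous_monomial _ hd
    rw [← h3] at h5
    exact h5.1
  · intro h
    have h3 : Jd J i = homogeneousSubmodule (Fin e) k i :=
      inf_eq_right.2 fun x hx => h (homog_mem hx)
    rw [h3] at h1
    omega

lemma hilb_below (he : 1 ≤ e) {J : Ideal (MvPolynomial (Fin e) k)} (hJ : HComp J) {t i : ℕ}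
    (ht : J ≤ qIdeal k e ^ t) (hi : i < t) : hilb k e J i = hQ e i := by
  have h1 := hilb_add he hJ i
  have h3 : Jd J i = ⊥ := by
    rw [eq_bot_iff]
    rintro x ⟨hx, hx'⟩
    have h5 : homogeneousComponent i x = x := homogeneousComponent_eq_self hx'
    rw [hc_eq_zero_of_mem hi (ht hx)] at h5
    simp [← h5]
  rw [h3, finrank_bot] at h1
  omega

lemma hilb_at (he : 1 ≤ e) {J : Ideal (MvPolynomial (Fin e) k)} (hJ : HComp J) {t : ℕ}
    (ht : IniDeg k e J t) : hilb k e J t < hQ e t := by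
  have h1 := hilb_add he hJ t
  by_contra hc
  have h3 : Jd J t = ⊥ := Submodule.finrank_eq_zero.1 (by omega)
  apply ht.2
  intro f hf
  have h4 := sub_hc_mem (ht.1 hf)
  have h5 : homogeneousComponent t f ∈ Jd J t := ⟨hJ f hf t, homogeneousComponent_mem t f⟩
  rw [h3, Submodule.mem_bot] at h5
  rwa [h5, sub_zero] at h4

lemma one_notMem_q : (1 : MvPolynomial (Fin e) k) ∉ qIdeal k e := by
  intro h
  rw [← pow_one (qIdeal k e), mem_q_pow] at h
  simpa using h 0 (by simp)

lemma pow_le_pow_q (he : 1 ≤ e) {a b : ℕ} (h : qIdeal k e ^ a ≤ qIdeal k e ^ b) : b ≤ a := by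
  have h1 : (X ⟨0, he⟩ : MvPolynomial (Fin e) k) ^ a ∈ qIdeal k e ^ a :=
    homog_mem (by simpa using (isHomogeneous_X k (⟨0, he⟩ : Fin e)).pow a)
  have h2 := h h1
  rw [X_pow_eq_monomial] at h2
  have := (monomial_mem_pow_idealOfVars_iff b _ one_ne_zero).1 h2
  simpa using this

lemma type_absurd {J : Ideal (MvPolynomial (Fin e) k)} (h1 : HasTypeOne k e J)
    (h2 : HasTypeTwo k e J) : False := by
  obtain ⟨x, hx, hc⟩ := h1
  obtain ⟨u, v, hc', huv⟩ := h2
  have hu : u ∈ J ⊔ Ideal.span {x} := by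
    rw [← hc, hc']; exact Ideal.mem_sup_right (Ideal.subset_span (by simp))
  have hv : v ∈ J ⊔ Ideal.span {x} := by
    rw [← hc, hc']; exact Ideal.mem_sup_right (Ideal.subset_span (by simp))
  have hxq : x ∈ J.colon (qIdeal k e) := by
    rw [hc]; exact Ideal.mem_sup_right (Ideal.subset_span (by simp))
  obtain ⟨j, hj, y, hy, rfl⟩ := Submodule.mem_sup.1 hu
  obtain ⟨j', hj', y', hy', rfl⟩ := Submodule.mem_sup.1 hv
  obtain ⟨a, rfl⟩ := Ideal.mem_span_singleton'.1 hy
  obtain ⟨b, rfl⟩ := Ideal.mem_span_singleton'.1 hy'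
  have h3 := huv b (-a) (by
    have : b * (j + a * x) + -a * (j' + b * x) = b * j - a * j' := by ring
    rw [this]
    exact sub_mem (J.mul_mem_left _ hj) (J.mul_mem_left _ hj'))
  have ha : a ∈ qIdeal k e := by simpa using h3.2
  have hax : a * x ∈ J := by
    have := Submodule.mem_colon.1 hxq a ha
    rwa [smul_eq_mul, mul_comm] at this
  have h4 := huv 1 0 (by simpa using add_mem hj hax)
  exact one_notMem_q h4.1

lemma soc_le {I J : Ideal (MvPolynomial (Fin e) k)} {σ : ℕ} (h1 : HasTypeOne k e I)
    (hs : SocDeg k e I σ) (hJ : ¬ J ≤ I) : qIdeal k e ^ σ ≤ I ⊔ J := by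
  classical
  obtain ⟨x, hx, hc⟩ := h1
  have hxq : x ∈ I.colon (qIdeal k e) := by
    rw [hc]; exact Ideal.mem_sup_right (Ideal.subset_span (by simp))
  have hex : ∃ n, qIdeal k e ^ n * J ≤ I := ⟨σ + 1, Ideal.mul_le_left.trans hs.2⟩
  obtain ⟨m, hm, hm'⟩ : ∃ m, ¬ qIdeal k e ^ m * J ≤ I ∧ qIdeal k e ^ (m + 1) * J ≤ I := by
    have h0 := Nat.find_spec hex
    cases hn : Nat.find hex with
    | zero => rw [hn] at h0; simp at h0; exact absurd h0 hJ
    | succ m =>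
      rw [hn] at h0
      exact ⟨m, Nat.find_min hex (by omega), h0⟩
  obtain ⟨z, hz, hzI⟩ := SetLike.not_le_iff_exists.1 hm
  have hzJ : z ∈ J := Ideal.mul_le_right hz
  have hzc : z ∈ I.colon (qIdeal k e) := by
    rw [Submodule.mem_colon]
    intro p hp
    rw [smul_eq_mul, mul_comm]
    apply hm'
    rw [pow_succ', mul_assoc]
    exact Ideal.mul_mem_mul hp hz
  rw [hc] at hzc
  obtain ⟨j, hj, y, hy, rfl⟩ := Submodule.mem_sup.1 hzc
  obtain ⟨a, rfl⟩ := Ideal.mem_span_singleton'.1 hy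
  have hqx : ∀ p ∈ qIdeal k e, p * x ∈ I := by
    intro p hp
    have := Submodule.mem_colon.1 hxq p hp
    rwa [smul_eq_mul, mul_comm] at this
  have ha0 : a - C (coeff 0 a) ∈ qIdeal k e := by
    have := sub_hc_mem (n := 0) (p := a) (by simp)
    simpa [homogeneousComponent_zero] using this
  have hc0 : coeff 0 a ≠ 0 := by
    intro h
    rw [h] at ha0
    simp only [map_zero, sub_zero] at ha0
    exact hzI (add_mem hj (hqx a ha0))
  have hxK : x ∈ I ⊔ J := by
    have h5 : x = C (coeff 0 a)⁻¹ * ((j + a * x) - j - (a - C (coeff 0 a)) * x) := by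
      have : (j + a * x) - j - (a - C (coeff 0 a)) * x = C (coeff 0 a) * x := by ring
      rw [this, ← mul_assoc, ← C_mul, inv_mul_cancel₀ hc0, C_1, one_mul]
    rw [h5]
    exact Ideal.mul_mem_left _ _ (sub_mem (sub_mem (Ideal.mem_sup_right hzJ)
      (Ideal.mem_sup_left hj)) (Ideal.mem_sup_left (hqx _ ha0)))
  have h6 : qIdeal k e ^ σ ≤ I.colon (qIdeal k e) := by
    intro p hp
    rw [Submodule.mem_colon]
    intro r hr
    rw [smul_eq_mul]
    apply hs.2
    rw [pow_succ]
    exact Ideal.mul_mem_mul hp hr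
  rw [hc] at h6
  refine h6.trans (sup_le le_sup_left ?_)
  rw [Ideal.span_le]
  simpa using hxK

lemma hQ_zero (e : ℕ) : hQ e 0 = 1 := by simp [hQ]

lemma hQ_pos (e i : ℕ) : 0 < hQ e i := Nat.choose_pos (by omega)

lemma hQ_strictMono (he : 3 ≤ e) : StrictMono (hQ e) := by
  apply strictMono_nat_of_lt_succ
  intro i
  obtain ⟨m, rfl⟩ : ∃ m, e = m + 2 := ⟨e - 2, by omega⟩
  simp only [hQ]
  rw [show m + 2 - 1 = m + 1 by omega, show m + 1 + (i + 1) = (m + 1 + i) + 1 by omega,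
    Nat.choose_succ_succ']
  have : 0 < (m + 1 + i).choose m := Nat.choose_pos (by omega)
  omega

lemma hQat_anti (he : 3 ≤ e) (σ i : ℕ) : hQat e σ (i + 1) ≤ hQat e σ i := by
  unfold hQat
  split_ifs with h1 h2
  · exact (hQ_strictMono he).monotone (by omega)
  · omega
  · omega
  · omega

end Helpers

/-- In the setup of two homogeneous compressed Gorenstein
ideals `I1, I2 ⊆ q^2` in `e ≥ 3` variables with `R = Q/(I1 ∩ I2)` compressed of
type 2, setting `R' = Q/(I1 + I2)` with socle degree `s'` and initial degree
`t'`, one has `2 ≤ t' ≤ s' + 1 ≤ t ≤ s' + 2` where `t` is the initial degree of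
`I1 ∩ I2`; moreover `h_{R'}(i) = max{0, h_{R1}(i) + h_{R2}(i) − h_Q(i)}` for
all `i ≥ 0`. -/
theorem stmt13 (k : Type*) [Field k] (e : ℕ) (he : 3 ≤ e)
    (I1 I2 : Ideal (MvPolynomial (Fin e) k))
    (h1hom : IsHomogeneousIdeal k e I1) (h2hom : IsHomogeneousIdeal k e I2)
    (h1p : I1.IsPrimary) (h1r : I1.radical = qIdeal k e)
    (h2p : I2.IsPrimary) (h2r : I2.radical = qIdeal k e)
    (h1q2 : I1 ≤ qIdeal k e ^ 2) (h2q2 : I2 ≤ qIdeal k e ^ 2)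
    (h1gor : HasTypeOne k e I1) (h2gor : HasTypeOne k e I2)
    (s1 s2 s t s' t' : ℕ)
    (hs1 : SocDeg k e I1 s1) (hs2 : SocDeg k e I2 s2) (hle : s1 ≤ s2)
    (h1c : CompressedGor k e I1 s1) (h2c : CompressedGor k e I2 s2)
    (htype2 : HasTypeTwo k e (I1 ⊓ I2))
    (hs : SocDeg k e (I1 ⊓ I2) s) (ht : IniDeg k e (I1 ⊓ I2) t)
    -- `R` is compressed
    (hcomp : ∃ b ≤ s, ∀ i,
      hilb k e (I1 ⊓ I2) i = min (hQ e i) (hQat e b i + hQat e s i))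
    (hs' : SocDeg k e (I1 + I2) s') (ht' : IniDeg k e (I1 + I2) t') :
    (2 ≤ t' ∧ t' ≤ s' + 1 ∧ s' + 1 ≤ t ∧ t ≤ s' + 2) ∧
    ∀ i : ℕ, hilb k e (I1 + I2) i = hilb k e I1 i + hilb k e I2 i - hQ e i := by
  have he1 : 1 ≤ e := by omega
  have hc1 := h1hom.hcomp
  have hc2 := h2hom.hcomp
  have hmv := hilb_mv he1 hc1 hc2
  rw [Submodule.add_eq_sup] at *
  have hmono := hQ_strictMono he
  have hnle : ¬ I2 ≤ I1 := by
    intro h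
    rw [inf_eq_right.2 h] at htype2
    exact type_absurd h2gor htype2
  have hsoc := soc_le h1gor hs1 hnle
  have hz1 := (hilb_zero_iff he1 (hc1.sup hc2) s1).2 hsoc
  -- the socle degree of the intersection
  have hss : s = s2 := by
    apply le_antisymm
    · by_contra hlt
      apply hs.1
      exact le_inf ((Ideal.pow_le_pow_right (by omega)).trans hs1.2)
        ((Ideal.pow_le_pow_right (by omega)).trans hs2.2)
    · by_contra hlt
      exact hs2.1 ((Ideal.pow_le_pow_right (by omega)).trans (hs.2.trans inf_le_right))
  subst hss
  obtain ⟨b, hb, hcomp⟩ := hcomp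
  have hA := hmv s1
  rw [hz1, h1c s1, h2c s1, hcomp s1] at hA
  have hbs : b = s1 := by
    have e1 : hQat e s1 s1 = 1 := by simp [hQat, hQ_zero]
    have e2 : hQat e s s1 = hQ e (s - s1) := by simp [hQat, hle]
    have e3 := hQ_pos e s1
    rcases lt_trichotomy b s1 with h | h | h
    · have e4 : hQat e b s1 = 0 := by simp [hQat, h]
      omega
    · exact h
    · exfalso
      have hB := hmv b
      rw [h1c b, h2c b, hcomp b] at hB
      have e5 : hQat e b b = 1 := by simp [hQat, hQ_zero]
      have e6 : hQat e s1 b = 0 := by simp [hQat, h]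
      have e7 : hQat e s b = hQ e (s - b) := by simp [hQat, hb]
      have e8 : hQ e b ≤ hQ e (s - b) := by omega
      have e9 : b ≤ s - b := hmono.le_iff_le.1 e8
      have e10 : hQ e s1 ≤ hQ e (s - s1) := hmono.monotone (by omega)
      omega
  subst hbs
  have hform : ∀ i : ℕ, hilb k e (I1 ⊔ I2) i = hilb k e I1 i + hilb k e I2 i - hQ e i := by
    intro i
    have h := hmv i
    rw [hcomp i] at h
    have a1 := h1c i
    have a2 := h2c i
    omega
  refine ⟨⟨?_, ?_, ?_, ?_⟩, hform⟩
  · by_contra hlt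
    exact ht'.2 ((sup_le h1q2 h2q2).trans (Ideal.pow_le_pow_right (by omega)))
  · exact pow_le_pow_q he1 (hs'.2.trans ht'.1)
  · by_contra hlt
    have a0 := hilb_at he1 (hc1.inf hc2) ht
    have a1 := h1c t
    have a2 := h2c t
    have a3 := hcomp t
    have a4 := hform t
    have a5 : hilb k e (I1 ⊔ I2) t = 0 := by omega
    exact hs'.1 ((Ideal.pow_le_pow_right (by omega)).trans
      ((hilb_zero_iff he1 (hc1.sup hc2) t).1 a5))
  · by_contra hlt
    have a0 := (hilb_zero_iff he1 (hc1.sup hc2) (s' + 1)).2 hs'.2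
    have a1 := (hilb_zero_iff he1 (hc1.sup hc2) (s' + 1 + 1)).2
      ((Ideal.pow_le_pow_right (by omega)).trans hs'.2)
    have b0 := hilb_below he1 (hc1.inf hc2) ht.1 (i := s' + 1) (by omega)
    have b1 := hilb_below he1 (hc1.inf hc2) ht.1 (i := s' + 1 + 1) (by omega)
    have hsb : s' + 1 ≤ b := by
      by_contra hlt'
      exact hs'.1 ((Ideal.pow_le_pow_right (by omega)).trans hsoc)
    have m0 := hmv (s' + 1)
    have m1 := hmv (s' + 1 + 1)
    rw [a0, b0, h1c, h2c] at m0
    rw [a1, b1, h1c, h2c] at m1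
    have p1 : 0 < hQat e b (s' + 1) := by
      rw [hQat, if_pos hsb]; exact hQ_pos _ _
    have p2 : 0 < hQat e s (s' + 1) := by
      rw [hQat, if_pos (by omega)]; exact hQ_pos _ _
    have p3 := hQ_pos e (s' + 1)
    have p4 := hQat_anti he b (s' + 1)
    have p5 := hQat_anti he s (s' + 1)
    have p6 : hQ e (s' + 1) < hQ e (s' + 1 + 1) := hmono (by omega)
    omega
end

section
/- Let Q = k[[x,y,z]] with maximal ideal q and let J ⊆ q^2 be a q-primary homogeneous ideal such that S = Q/J is compressed Gorenstein of even socle degree s and initial degree t. Then the minimal graded free resolution of S over Q has the form Q ← Q^{2t+1}(−t) ← Q^{2t+1}(−t−1) ← Q(−s−3) ← 0. -/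
open MvPolynomial

section Basics
variable {k : Type*} [Field k]

theorem aux_hc_mul_right {m : ℕ} {a b : MvPolynomial (Fin 3) k} (hb : b.IsHomogeneous m) (n : ℕ) :
    homogeneousComponent n (a * b) = if m ≤ n then homogeneousComponent (n - m) a * b else 0 := by
  let _ := MvPolynomial.gradedAlgebra (σ := Fin 3) (R := k)
  have := DirectSum.coe_decompose_mul_of_right_mem (homogeneousSubmodule (Fin 3) k) n (a := a) (b := b)
    (i := m) hb
  have key : ∀ (f : MvPolynomial (Fin 3) k) (i : ℕ),
      (DirectSum.decompose (homogeneousSubmodule (Fin 3) k) f i : MvPolynomial (Fin 3) k)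
        = homogeneousComponent i f := fun f i => decomposition.decompose'_apply f i
  rw [key, key] at this
  exact this

theorem aux_hc_mul_left {m : ℕ} {a b : MvPolynomial (Fin 3) k} (hb : b.IsHomogeneous m) (n : ℕ) :
    homogeneousComponent n (b * a) = if m ≤ n then b * homogeneousComponent (n - m) a else 0 := by
  rw [mul_comm, aux_hc_mul_right hb]
  simp only [mul_comm]

theorem aux_hc_X_mul (i : Fin 3) (n : ℕ) (a : MvPolynomial (Fin 3) k) :
    homogeneousComponent (n + 1) (X i * a) = X i * homogeneousComponent n a := by
  rw [aux_hc_mul_left (isHomogeneous_X k i)]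
  simp

theorem aux_split {n : ℕ} {f : MvPolynomial (Fin 3) k} (hf : f.IsHomogeneous (n + 1)) :
    ∃ h : Fin 3 → MvPolynomial (Fin 3) k, (∀ a, (h a).IsHomogeneous n) ∧ f = ∑ a, X a * h a := by
  have h1 : f ∈ idealOfVars (Fin 3) k ^ 1 := by
    rw [mem_pow_idealOfVars_iff']
    intro x hx
    exact hf.coeff_eq_zero (by omega)
  rw [pow_one, Ideal.mem_span_range_iff_exists_fun] at h1
  obtain ⟨c, hc⟩ := h1
  refine ⟨fun a => homogeneousComponent n (c a), fun a => homogeneousComponent_isHomogeneous _ _, ?_⟩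
  rw [← homogeneousComponent_eq_self hf, ← hc, map_sum]
  exact Finset.sum_congr rfl fun a _ => by rw [mul_comm, aux_hc_X_mul]

theorem aux_mem_of_comp {ι : Type*} [Finite ι] (V : Submodule (MvPolynomial (Fin 3) k) (ι → MvPolynomial (Fin 3) k))
    (c : ι → MvPolynomial (Fin 3) k)
    (h : ∀ n, (fun i => homogeneousComponent n (c i)) ∈ V) : c ∈ V := by
  classical
  have := Fintype.ofFinite ι
  set N := Finset.univ.sup (fun i => (c i).totalDegree) with hN
  have : c = ∑ n ∈ Finset.range (N + 1), fun i => homogeneousComponent n (c i) := by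
    funext i
    rw [Finset.sum_apply]
    have hi : (c i).totalDegree ≤ N := Finset.le_sup (f := fun i => (c i).totalDegree) (Finset.mem_univ i)
    conv_lhs => rw [← sum_homogeneousComponent (c i)]
    apply Finset.sum_subset
    · intro x; simp; omega
    · intro x _ hx
      simp at hx
      exact homogeneousComponent_eq_zero _ _ (by omega)
  rw [this]
  exact V.sum_mem fun n _ => h n

/-- Koszul exactness, left spot. -/
theorem aux_K1 (u : Fin 3 → MvPolynomial (Fin 3) k)
    (h : ∀ a b, X b * u a = X a * u b) : ∃ w, ∀ a, u a = X a * w := by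
  have h01 := h 0 1
  have hd : (X 0 : MvPolynomial (Fin 3) k) ∣ X 1 * u 0 := ⟨u 1, h01⟩
  rcases (X_prime (R := k) (i := (0 : Fin 3))).dvd_or_dvd hd with h1 | h1
  · rw [X_dvd_X] at h1
    simp at h1
  · obtain ⟨w, hw⟩ := h1
    refine ⟨w, fun a => ?_⟩
    have := h 0 a
    rw [hw] at this
    apply mul_left_cancel₀ (X_ne_zero (R := k) (0 : Fin 3))
    rw [← this]; ring

theorem aux_K1' {p q : MvPolynomial (Fin 3) k} (h : X 0 * p + X 1 * q = 0) :
    ∃ c, p = X 1 * c ∧ q = - X 0 * c := by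
  have hd : (X 0 : MvPolynomial (Fin 3) k) ∣ X 1 * q := ⟨-p, by linear_combination h⟩
  rcases (X_prime (R := k) (i := (0 : Fin 3))).dvd_or_dvd hd with h1 | h1
  · rw [X_dvd_X] at h1
    simp at h1
  · obtain ⟨w, hw⟩ := h1
    refine ⟨-w, ?_, by rw [hw]; ring⟩
    rw [hw] at h
    apply mul_left_cancel₀ (X_ne_zero (R := k) (0 : Fin 3))
    linear_combination h

/-- Koszul exactness, middle spot. -/
theorem aux_K2 (u : Fin 3 → MvPolynomial (Fin 3) k)
    (h : ∑ a, X a * u a = 0) : ∃ p : Fin 3 → MvPolynomial (Fin 3) k,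
      ∀ a, u a = X (a + 1) * p (a + 2) - X (a + 2) * p (a + 1) := by
  rw [Fin.sum_univ_three] at h
  have hm : X 2 * u 2 ∈ Ideal.span (Set.image X ({0, 1} : Set (Fin 3)) : Set (MvPolynomial (Fin 3) k)) := by
    have e : X 2 * u 2 = -(u 0) * X 0 + -(u 1) * X 1 := by linear_combination h
    rw [e]
    refine Ideal.add_mem _ (Ideal.mul_mem_left _ _ (Ideal.subset_span ⟨0, by simp, rfl⟩))
      (Ideal.mul_mem_left _ _ (Ideal.subset_span ⟨1, by simp, rfl⟩))
  have hm2 : u 2 ∈ Ideal.span (Set.image X ({0, 1} : Set (Fin 3)) : Set (MvPolynomial (Fin 3) k)) := by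
    rw [mem_ideal_span_X_image] at hm ⊢
    intro m hmm
    obtain ⟨i, hi, him⟩ := hm (Finsupp.single 2 1 + m) (by
      rw [mem_support_iff] at hmm ⊢
      rwa [coeff_X_mul])
    refine ⟨i, hi, ?_⟩
    rcases hi with rfl | rfl <;> simpa using him
  rw [Set.image_pair, Ideal.mem_span_pair] at hm2
  obtain ⟨a, b, hab⟩ := hm2
  obtain ⟨c, hc1, hc2⟩ := aux_K1' (p := u 0 + X 2 * a) (q := u 1 + X 2 * b) (by
    linear_combination h + X 2 * hab)
  refine ⟨![-b, a, c], ?_⟩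
  intro i
  fin_cases i
  · simp; linear_combination hc1
  · simp; linear_combination hc2
  · simp; linear_combination -hab

end Basics

section Pairing

/-- Working package of facts about a compressed Gorenstein ideal. -/
structure AuxCtx (k : Type*) [Field k] (J : Ideal (MvPolynomial (Fin 3) k)) (s t : ℕ)
    (x₀ : MvPolynomial (Fin 3) k) : Prop where
  hJ : ∀ f ∈ J, ∀ n, homogeneousComponent n f ∈ J
  hlow : ∀ n, n < t → ∀ f ∈ J, f.IsHomogeneous n → f = 0
  htop : ∀ n, s < n → ∀ f : MvPolynomial (Fin 3) k, f.IsHomogeneous n → f ∈ J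
  hx : x₀.IsHomogeneous s
  hxJ : x₀ ∉ J
  hxs : ∀ a, X a * x₀ ∈ J
  hsoc : ∀ f, (∀ a, X a * f ∈ J) → ∃ j ∈ J, ∃ c, f = j + c * x₀
  hst : s + 2 = 2 * t
  ht : 2 ≤ t

variable {k : Type*} [Field k] {J : Ideal (MvPolynomial (Fin 3) k)} {s t : ℕ}
    {x₀ : MvPolynomial (Fin 3) k}

theorem aux_phi (H : AuxCtx k J s t x₀) : ∃ φ : MvPolynomial (Fin 3) k →ₗ[k] k,
    (∀ f ∈ J, φ f = 0) ∧
    (∀ m i, i + m = s → ∀ f : MvPolynomial (Fin 3) k, f.IsHomogeneous i →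
      (∀ u : MvPolynomial (Fin 3) k, u.IsHomogeneous m → φ (f * u) = 0) → f ∈ J) := by
  obtain ⟨φ₀, h1, h2⟩ := Submodule.exists_dual_map_eq_bot_of_notMem (R := k)
    (p := J.restrictScalars k) (x := x₀) H.hxJ inferInstance
  have h3 : ∀ f ∈ J, φ₀ f = 0 := fun f hf => by
    have : φ₀ f ∈ (J.restrictScalars k).map φ₀ := ⟨f, hf, rfl⟩
    rwa [h2] at this
  refine ⟨φ₀ ∘ₗ homogeneousComponent s, fun f hf => h3 _ (H.hJ f hf s), ?_⟩
  intro m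
  induction m with
  | zero =>
    intro i hi f hf hu
    obtain rfl : i = s := by omega
    have h4 := hu 1 (isHomogeneous_one _ _)
    obtain ⟨j, hj, c, hc⟩ := H.hsoc f (fun a => H.htop _ (lt_add_of_pos_left i (zero_lt_one)) _ ((isHomogeneous_X k a).mul hf))
    have e : f = homogeneousComponent i j + coeff 0 c • x₀ := by
      conv_lhs => rw [← homogeneousComponent_eq_self hf, hc, map_add, aux_hc_mul_right H.hx]
      simp [smul_eq_C_mul]
    have h5 : homogeneousComponent i j ∈ J := H.hJ j hj i
    rw [mul_one, LinearMap.comp_apply, homogeneousComponent_eq_self hf, e, map_add, h3 _ h5, zero_add,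
      map_smul, smul_eq_mul, mul_eq_zero] at h4
    rcases h4 with h4 | h4
    · rw [h4, zero_smul, add_zero] at e
      rw [e]; exact h5
    · exact absurd h4 h1
  | succ m ih =>
    intro i hi f hf hu
    have hX : ∀ a, X a * f ∈ J := fun a => by
      refine ih (1 + i) (by omega) _ ((isHomogeneous_X k a).mul hf) fun u hu' => ?_
      have := hu (u * X a) (hu'.mul (isHomogeneous_X k a))
      rw [← this]; congr 1; ring
    obtain ⟨j, hj, c, hc⟩ := H.hsoc f hX
    have e : f = homogeneousComponent i j := by
      conv_lhs => rw [← homogeneousComponent_eq_self hf, hc, map_add, aux_hc_mul_right H.hx]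
      rw [if_neg (by omega), add_zero]
    rw [e]; exact H.hJ j hj i

theorem aux_repr (φ : MvPolynomial (Fin 3) k →ₗ[k] k)
    (hφ : ∀ m i, i + m = s → ∀ f : MvPolynomial (Fin 3) k, f.IsHomogeneous i →
      (∀ u : MvPolynomial (Fin 3) k, u.IsHomogeneous m → φ (f * u) = 0) → f ∈ J)
    {i m : ℕ} (him : i + m = s) (ψ : MvPolynomial (Fin 3) k →ₗ[k] k)
    (hψ : ∀ f ∈ J, f.IsHomogeneous i → ψ f = 0) :
    ∃ u : MvPolynomial (Fin 3) k, u.IsHomogeneous m ∧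
      ∀ f : MvPolynomial (Fin 3) k, f.IsHomogeneous i → ψ f = φ (f * u) := by
  let E := homogeneousSubmodule (Fin 3) k i
  let L : homogeneousSubmodule (Fin 3) k m → E →ₗ[k] k :=
    fun u => (φ ∘ₗ LinearMap.mulRight k (u : MvPolynomial (Fin 3) k)) ∘ₗ E.subtype
  have : FiniteDimensional k E := Module.Finite.iff_fg.2 (homogeneousSubmodule_fg (Fin 3) k i)
  have hmem : ψ ∘ₗ E.subtype ∈ Submodule.span k (Set.range L) := by
    apply FiniteDimensional.mem_span_of_iInf_ker_le_ker
    intro f hf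
    rw [Submodule.mem_iInf] at hf
    rw [LinearMap.mem_ker]
    refine hψ _ (hφ m i him _ f.2 fun u hu => ?_) f.2
    exact hf ⟨u, hu⟩
  have key : ∀ K ∈ Submodule.span k (Set.range L), ∃ u, K = L u := by
    intro K hK
    induction hK using Submodule.span_induction with
    | mem x hx => obtain ⟨u, rfl⟩ := hx; exact ⟨u, rfl⟩
    | zero => exact ⟨0, by ext; simp [L]⟩
    | add x y _ _ hx hy =>
      obtain ⟨u, rfl⟩ := hx
      obtain ⟨v, rfl⟩ := hy
      exact ⟨u + v, by ext; simp [L, mul_add]⟩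
    | smul a x _ hx =>
      obtain ⟨u, rfl⟩ := hx
      exact ⟨a • u, by ext; simp [L]⟩
  obtain ⟨u, hu⟩ := key _ hmem
  refine ⟨u, u.2, fun f hf => ?_⟩
  exact LinearMap.congr_fun hu ⟨f, hf⟩

/-- `J` is generated in degree `t`. -/
theorem aux_S1 (H : AuxCtx k J s t x₀) {j : ℕ} (hj : t ≤ j) {f : MvPolynomial (Fin 3) k}
    (hf : f.IsHomogeneous (j + 1)) (hfJ : f ∈ J) :
    ∃ h : Fin 3 → MvPolynomial (Fin 3) k, (∀ a, (h a).IsHomogeneous j) ∧ (∀ a, h a ∈ J) ∧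
      f = ∑ a, X a * h a := by
  obtain ⟨h₀, hh₀, hf₀⟩ := aux_split hf
  by_cases hjs : s < j
  · exact ⟨h₀, hh₀, fun a => H.htop j hjs _ (hh₀ a), hf₀⟩
  by_contra hcon
  obtain ⟨φ, hφ1, hφ2⟩ := aux_phi H
  let W : Submodule k (MvPolynomial (Fin 3) k) :=
    { carrier := {f | ∃ h : Fin 3 → MvPolynomial (Fin 3) k,
        (∀ a, (h a).IsHomogeneous j) ∧ (∀ a, h a ∈ J) ∧ f = ∑ a, X a * h a}
      zero_mem' := ⟨0, fun a => isHomogeneous_zero _ _ _, fun a => J.zero_mem, by simp⟩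
      add_mem' := by
        rintro _ _ ⟨h, h1, h2, rfl⟩ ⟨h', h1', h2', rfl⟩
        exact ⟨h + h', fun a => (h1 a).add (h1' a), fun a => J.add_mem (h2 a) (h2' a), by
          simp [mul_add, Finset.sum_add_distrib]⟩
      smul_mem' := by
        rintro c _ ⟨h, h1, h2, rfl⟩
        refine ⟨c • h, fun a => Submodule.smul_mem (homogeneousSubmodule (Fin 3) k j) c (h1 a),
          fun a => Submodule.smul_mem (J.restrictScalars k) c (h2 a), by
          simp [Finset.smul_sum]⟩ }
  obtain ⟨ψ, h1, h2⟩ := Submodule.exists_dual_map_eq_bot_of_notMem (R := k)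
    (p := W) (x := f) hcon inferInstance
  have h3 : ∀ a, ∀ f ∈ J, f.IsHomogeneous j → ψ (X a * f) = 0 := fun a f hf hfj => by
    have : ψ (X a * f) ∈ W.map ψ := by
      refine ⟨_, ⟨fun b => if b = a then f else 0, ?_, ?_, ?_⟩, rfl⟩
      · intro b; beta_reduce; split_ifs
        · exact hfj
        · exact isHomogeneous_zero _ _ _
      · intro b; beta_reduce; split_ifs
        · exact hf
        · exact J.zero_mem
      · simp
    rwa [h2] at this
  have h4 := fun a => aux_repr φ hφ2 (i := j) (m := s - j) (by omega)
    (ψ ∘ₗ LinearMap.mulLeft k (X a)) (fun f hf hfj => h3 a f hf hfj)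
  choose u hu1 hu2 using h4
  obtain ⟨w, hw⟩ := aux_K1 u (fun a b => by
    rw [← sub_eq_zero]
    have hh : (X b * u a - X a * u b).IsHomogeneous (s - j + 1) := by
      rw [add_comm]
      exact ((isHomogeneous_X k b).mul (hu1 a)).sub ((isHomogeneous_X k a).mul (hu1 b))
    have hst := H.hst
    refine H.hlow _ (by omega) _ (hφ2 (j - 1) (s - j + 1) (by have := H.ht; omega) _ hh ?_) hh
    intro e he
    have e1 := hu2 a (X b * e) (by
      have := (isHomogeneous_X k b).mul he
      rwa [show 1 + (j - 1) = j by have := H.ht; omega] at this)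
    have e2 := hu2 b (X a * e) (by
      have := (isHomogeneous_X k a).mul he
      rwa [show 1 + (j - 1) = j by have := H.ht; omega] at this)
    simp only [LinearMap.comp_apply, LinearMap.mulLeft_apply] at e1 e2
    rw [show (X b * u a - X a * u b) * e = X b * e * u a - X a * e * u b by ring, map_sub, ← e1, ← e2,
      ← map_sub, show X a * (X b * e) - X b * (X a * e) = 0 by ring, map_zero])
  apply h1
  have e3 : ψ f = φ (f * w) := by
    rw [hf₀, map_sum, Finset.sum_mul, map_sum]
    refine Finset.sum_congr rfl fun a _ => ?_
    rw [show X a * h₀ a * w = h₀ a * u a by rw [hw a]; ring]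
    exact hu2 a _ (hh₀ a)
  rw [e3]
  exact hφ1 _ (J.mul_mem_right _ hfJ)

/-- Exactness of the Koszul complex of `S` at the last but one spot, in high degrees. -/
theorem aux_S2 (H : AuxCtx k J s t x₀) {n : ℕ} (hn : t ≤ n) {h : Fin 3 → MvPolynomial (Fin 3) k}
    (hh : ∀ a, (h a).IsHomogeneous n) (hJ : ∀ a b, X a * h b - X b * h a ∈ J) :
    ∃ w, ∀ a, h a - X a * w ∈ J := by
  by_cases hns : s < n
  · exact ⟨0, fun a => H.htop n hns _ (by simpa using hh a)⟩
  by_contra hcon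
  obtain ⟨φ, hφ1, hφ2⟩ := aux_phi H
  let W : Submodule k (Fin 3 → MvPolynomial (Fin 3) k) :=
    { carrier := {h | ∃ w, ∀ a, h a - X a * w ∈ J}
      zero_mem' := ⟨0, fun a => by simp⟩
      add_mem' := by
        rintro h h' ⟨w, hw⟩ ⟨w', hw'⟩
        exact ⟨w + w', fun a => by
          have := J.add_mem (hw a) (hw' a)
          convert this using 1
          simp only [Pi.add_apply]; ring⟩
      smul_mem' := by
        rintro c h ⟨w, hw⟩
        refine ⟨c • w, fun a => ?_⟩
        have := Submodule.smul_mem (J.restrictScalars k) c (hw a)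
        simpa [smul_sub] using this }
  obtain ⟨Ψ, h1, h2⟩ := Submodule.exists_dual_map_eq_bot_of_notMem (R := k)
    (p := W) (x := h) hcon inferInstance
  have h3 : ∀ f ∈ W, Ψ f = 0 := fun f hf => by
    have : Ψ f ∈ W.map Ψ := ⟨f, hf, rfl⟩
    rwa [h2] at this
  have h4 := fun a => aux_repr φ hφ2 (i := n) (m := s - n) (by omega)
    (Ψ ∘ₗ LinearMap.single k (fun _ : Fin 3 => MvPolynomial (Fin 3) k) a) (fun f hf _ => h3 _ ⟨0, fun b => by
      by_cases hb : b = a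
      · subst hb; simpa using hf
      · simp [hb]⟩)
  choose u hu1 hu2 using h4
  have hΨ : ∀ f : Fin 3 → MvPolynomial (Fin 3) k, (∀ a, (f a).IsHomogeneous n) →
      Ψ f = φ (∑ a, f a * u a) := by
    intro f hf
    rw [map_sum]
    conv_lhs => rw [← Finset.univ_sum_single f, map_sum]
    exact Finset.sum_congr rfl fun a _ => hu2 a _ (hf a)
  obtain ⟨p, hp⟩ := aux_K2 u (by
    have hh : (∑ a, X a * u a).IsHomogeneous (s - n + 1) := by
      apply IsHomogeneous.sum
      intro a _
      rw [add_comm]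
      exact (isHomogeneous_X k a).mul (hu1 a)
    have hst := H.hst
    refine H.hlow _ (by omega) _ (hφ2 (n - 1) (s - n + 1) (by have := H.ht; omega) _ hh ?_) hh
    intro e he
    have e1 := hΨ (fun a => X a * e) (fun a => by
      have := (isHomogeneous_X k a).mul he
      rwa [show 1 + (n - 1) = n by have := H.ht; omega] at this)
    rw [h3 _ ⟨e, fun a => by simp⟩] at e1
    rw [e1, Finset.sum_mul]
    congr 1
    exact Finset.sum_congr rfl fun a _ => by ring)
  apply h1
  rw [hΨ h hh]
  apply hφ1
  have e : ∑ a, h a * u a = p 0 * (X 2 * h 1 - X 1 * h 2) + p 1 * (X 0 * h 2 - X 2 * h 0)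
      + p 2 * (X 1 * h 0 - X 0 * h 1) := by
    rw [Fin.sum_univ_three, hp 0, hp 1, hp 2]
    simp only [Fin.isValue, zero_add, Fin.reduceAdd]
    ring
  rw [e]
  exact J.add_mem (J.add_mem (J.mul_mem_left _ (hJ _ _)) (J.mul_mem_left _ (hJ _ _)))
    (J.mul_mem_left _ (hJ _ _))

end Pairing

section Resolution

variable {k : Type*} [Field k] {ι κ : Type*}

/-- Componentwise homogeneous component. -/
noncomputable def auxHcv (n : ℕ) (c : ι → MvPolynomial (Fin 3) k) : ι → MvPolynomial (Fin 3) k :=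
  fun i => homogeneousComponent n (c i)

theorem auxHcv_self {n : ℕ} {c : ι → MvPolynomial (Fin 3) k} (h : ∀ i, (c i).IsHomogeneous n) :
    auxHcv n c = c := funext fun i => homogeneousComponent_eq_self (h i)

theorem auxHcv_hom (n : ℕ) (c : ι → MvPolynomial (Fin 3) k) (i : ι) :
    (auxHcv n c i).IsHomogeneous n := homogeneousComponent_isHomogeneous _ _

theorem auxHcv_sum_X (n : ℕ) (c : Fin 3 → ι → MvPolynomial (Fin 3) k) :
    auxHcv (n + 1) (∑ a, (X a : MvPolynomial (Fin 3) k) • c a) =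
      ∑ a, (X a : MvPolynomial (Fin 3) k) • auxHcv n (c a) := by
  funext i
  simp [auxHcv, Finset.sum_apply, aux_hc_X_mul]

theorem auxHcv_add (n : ℕ) (c d : ι → MvPolynomial (Fin 3) k) :
    auxHcv n (c + d) = auxHcv n c + auxHcv n d := by
  funext i; simp [auxHcv]

theorem aux_split_v {n : ℕ} {f : ι → MvPolynomial (Fin 3) k} (hf : ∀ i, (f i).IsHomogeneous (n + 1)) :
    ∃ h : Fin 3 → ι → MvPolynomial (Fin 3) k, (∀ a i, (h a i).IsHomogeneous n) ∧
      f = ∑ a, (X a : MvPolynomial (Fin 3) k) • h a := by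
  choose h h1 h2 using fun i => aux_split (hf i)
  exact ⟨fun a i => h i a, fun a i => h1 i a, by funext i; simp [h2 i, Finset.sum_apply]⟩

theorem aux_K2v (u : Fin 3 → ι → MvPolynomial (Fin 3) k)
    (h : ∑ a, (X a : MvPolynomial (Fin 3) k) • u a = 0) :
    ∃ p : Fin 3 → ι → MvPolynomial (Fin 3) k,
      ∀ a, u a = (X (a + 1) : MvPolynomial (Fin 3) k) • p (a + 2) -
        (X (a + 2) : MvPolynomial (Fin 3) k) • p (a + 1) := by
  choose p hp using fun i => aux_K2 (fun a => u a i) (by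
    have := congrFun h i
    simpa [Finset.sum_apply] using this)
  exact ⟨fun a i => p i a, fun a => funext fun i => by simpa using hp i a⟩

theorem aux_cross (R : Fin 3 → Fin 3 → Prop) (hsymm : ∀ a b, R a b → R b a)
    (hrefl : ∀ a, R a a) (h : ∀ a : Fin 3, R (a + 1) (a + 2)) (a b : Fin 3) : R a b := by
  have h0 := h 0
  have h1 := h 1
  have h2 := h 2
  simp only [Fin.isValue, zero_add, Fin.reduceAdd] at h0 h1 h2
  fin_cases a <;> fin_cases b <;> first | exact hrefl _ | assumption | (apply hsymm; assumption)

theorem aux_K1c (u : Fin 3 → MvPolynomial (Fin 3) k)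
    (h : ∀ a : Fin 3, X (a + 1) * u (a + 2) = X (a + 2) * u (a + 1)) :
    ∃ r, ∀ a, u a = X a * r := by
  apply aux_K1
  exact aux_cross (fun a b => X b * u a = X a * u b) 
    (fun a b h => h.symm) (fun a => rfl) (fun a => (h a).symm)

theorem aux_K1v (u : Fin 3 → ι → MvPolynomial (Fin 3) k)
    (h : ∀ a : Fin 3, (X (a + 1) : MvPolynomial (Fin 3) k) • u (a + 2)
      = (X (a + 2) : MvPolynomial (Fin 3) k) • u (a + 1)) :
    ∃ r, ∀ a, u a = (X a : MvPolynomial (Fin 3) k) • r := by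
  choose r hr using fun i => aux_K1c (fun a => u a i) (fun a => by simpa using congrFun (h a) i)
  exact ⟨r, fun a => funext fun i => by simpa using hr i a⟩

theorem aux_sum_cross {M : Type*} [AddCommGroup M] [Module (MvPolynomial (Fin 3) k) M] (l : Fin 3 → M) :
    ∑ a : Fin 3, (X a : MvPolynomial (Fin 3) k) • ((X (a + 1) : MvPolynomial (Fin 3) k) • l (a + 2) -
        (X (a + 2) : MvPolynomial (Fin 3) k) • l (a + 1)) = 0 := by
  rw [Fin.sum_univ_three]
  simp only [Fin.isValue, zero_add, Fin.reduceAdd]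
  module

variable {J : Ideal (MvPolynomial (Fin 3) k)} {s t : ℕ} {x₀ : MvPolynomial (Fin 3) k}

/-- `J` is generated by a spanning set of its degree `t` part. -/
theorem aux_gen [Fintype ι] (H : AuxCtx k J s t x₀) (g : ι → MvPolynomial (Fin 3) k)
    (hgJ : ∀ i, g i ∈ J)
    (hspan : ∀ f ∈ J, f.IsHomogeneous t → f ∈ Submodule.span k (Set.range g)) :
    J = Ideal.span (Set.range g) := by
  apply le_antisymm
  · have key : ∀ n, ∀ f ∈ J, f.IsHomogeneous n → f ∈ Ideal.span (Set.range g) := by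
      intro n
      induction n with
      | zero =>
        intro f hf hfn
        rw [H.hlow 0 (by have := H.ht; omega) f hf hfn]
        exact Ideal.zero_mem _
      | succ n ih =>
        intro f hf hfn
        rcases lt_trichotomy (n + 1) t with h | h | h
        · rw [H.hlow _ h f hf hfn]
          exact Ideal.zero_mem _
        · rw [h] at hfn
          have h1 := hspan f hf hfn
          exact Submodule.span_le_restrictScalars k (MvPolynomial (Fin 3) k) _ h1
        · obtain ⟨h', h1, h2, rfl⟩ := aux_S1 H (by omega) hfn hf
          exact Ideal.sum_mem _ fun a _ => Ideal.mul_mem_left _ _ (ih _ (h2 a) (h1 a))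
    intro f hf
    rw [← sum_homogeneousComponent f]
    exact Ideal.sum_mem _ fun n _ => key n _ (H.hJ f hf n) (homogeneousComponent_isHomogeneous _ _)
  · rw [Ideal.span_le]
    rintro _ ⟨i, rfl⟩
    exact hgJ i

theorem aux_syz [Finite ι] (H : AuxCtx k J s t x₀)
    (G : (ι → MvPolynomial (Fin 3) k) →ₗ[MvPolynomial (Fin 3) k] MvPolynomial (Fin 3) k)
    (hG : ∀ n c, homogeneousComponent (n + t) (G c) = G (auxHcv n c))
    (hGJ : ∀ f, f ∈ J ↔ ∃ c, f = G c)
    (V : Submodule (MvPolynomial (Fin 3) k) (ι → MvPolynomial (Fin 3) k))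
    (h0 : ∀ c, (∀ i, (c i).IsHomogeneous 0) → G c = 0 → c = 0)
    (h1 : ∀ c, (∀ i, (c i).IsHomogeneous 1) → G c = 0 → c ∈ V) :
    ∀ c, G c = 0 → c ∈ V := by
  have key : ∀ n c, (∀ i, (c i).IsHomogeneous n) → G c = 0 → c ∈ V := by
    intro n
    induction n with
    | zero => intro c hc h; rw [h0 c hc h]; exact V.zero_mem
    | succ n ih =>
      rcases n with _ | m
      · exact h1
      intro c hc hGc
      obtain ⟨C, hC1, hC2⟩ := aux_split_v hc
      have hCh : ∀ a, (G (C a)).IsHomogeneous (m + t + 1) := fun a => by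
        rw [← auxHcv_self (hC1 a), ← hG, show m + 1 + t = m + t + 1 by ring]
        exact homogeneousComponent_isHomogeneous _ _
      obtain ⟨p, hp⟩ := aux_K2 (fun a => G (C a)) (by
        rw [hC2, map_sum] at hGc
        simpa using hGc)
      have hp' : ∀ a, G (C a) = X (a + 1) * homogeneousComponent (m + t) (p (a + 2)) -
          X (a + 2) * homogeneousComponent (m + t) (p (a + 1)) := fun a => by
        rw [← homogeneousComponent_eq_self (hCh a), hp a, map_sub, aux_hc_X_mul, aux_hc_X_mul]
      obtain ⟨w, hw⟩ := aux_S2 H (n := m + t) (by omega)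
        (h := fun a => homogeneousComponent (m + t) (p a))
        (fun a => homogeneousComponent_isHomogeneous _ _)
        (aux_cross
          (fun a b => X a * homogeneousComponent (m + t) (p b) - X b * homogeneousComponent (m + t) (p a) ∈ J)
          (fun a b h => by rw [← neg_sub]; exact J.neg_mem h) (fun a => by simp)
          (fun a => by rw [← hp' a]; exact (hGJ _).2 ⟨_, rfl⟩))
      choose e he using fun a => (hGJ _).1 (hw a)
      let c' : Fin 3 → ι → MvPolynomial (Fin 3) k := fun a =>
        C a - ((X (a + 1) : MvPolynomial (Fin 3) k) • e (a + 2) -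
        (X (a + 2) : MvPolynomial (Fin 3) k) • e (a + 1))
      have hc' : ∀ a, G (c' a) = 0 := fun a => by
        simp only [c', map_sub, map_smul, ← he, hp' a, smul_eq_mul]
        ring
      have hcc : c = ∑ a, (X a : MvPolynomial (Fin 3) k) • c' a := by
        simp only [c', smul_sub _ (C _), Finset.sum_sub_distrib]
        rw [aux_sum_cross, sub_zero, hC2]
      rw [← auxHcv_self hc, hcc, auxHcv_sum_X]
      refine V.sum_mem fun a _ => V.smul_mem _ (ih _ (auxHcv_hom _ _) ?_)
      rw [← hG, hc' a, map_zero]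
  intro c hc
  refine aux_mem_of_comp V c fun n => key n _ (fun i => homogeneousComponent_isHomogeneous _ _) ?_
  have := hG n c
  rw [hc, map_zero] at this
  exact this.symm

theorem aux_ker [Finite ι] [Finite κ] (H : AuxCtx k J s t x₀)
    (G : (ι → MvPolynomial (Fin 3) k) →ₗ[MvPolynomial (Fin 3) k] MvPolynomial (Fin 3) k)
    (hG : ∀ n c, homogeneousComponent (n + t) (G c) = G (auxHcv n c))
    (hGJ : ∀ f, f ∈ J ↔ ∃ c, f = G c)
    (D : (κ → MvPolynomial (Fin 3) k) →ₗ[MvPolynomial (Fin 3) k] (ι → MvPolynomial (Fin 3) k))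
    (hD : ∀ n c, auxHcv (n + 1) (D c) = D (auxHcv n c))
    (hex : ∀ c, G c = 0 ↔ ∃ d, c = D d)
    (h0 : ∀ d, (∀ i, (d i).IsHomogeneous 0) → D d = 0 → d = 0) :
    ∃ v : κ → MvPolynomial (Fin 3) k, (∀ i, (v i).IsHomogeneous t) ∧ v ≠ 0 ∧
      ∀ d, D d = 0 ↔ ∃ r : MvPolynomial (Fin 3) k, d = r • v := by
  have ht := H.ht
  have hst := H.hst
  have hGD : ∀ d, G (D d) = 0 := fun d => (hex _).2 ⟨d, rfl⟩
  -- construction of `v`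
  choose y₁ hy₁ using fun a => (hGJ _).1 (H.hxs a)
  let y : Fin 3 → ι → MvPolynomial (Fin 3) k := fun a => auxHcv (t - 1) (y₁ a)
  have hy : ∀ a, G (y a) = X a * x₀ := fun a => by
    rw [← hG, ← hy₁, show t - 1 + t = s + 1 by omega]
    apply homogeneousComponent_eq_self
    rw [add_comm]
    exact (isHomogeneous_X k a).mul H.hx
  choose d₁ hd₁ using fun a : Fin 3 => (hex ((X (a + 1) : MvPolynomial (Fin 3) k) • y (a + 2) -
        (X (a + 2) : MvPolynomial (Fin 3) k) • y (a + 1))).1 (by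
      simp only [map_sub, map_smul, hy, smul_eq_mul]; ring)
  let d₀ : Fin 3 → κ → MvPolynomial (Fin 3) k := fun a => auxHcv (t - 1) (d₁ a)
  have hd₀ : ∀ a, D (d₀ a) = (X (a + 1) : MvPolynomial (Fin 3) k) • y (a + 2) -
        (X (a + 2) : MvPolynomial (Fin 3) k) • y (a + 1) := fun a => by
    rw [← hD, ← hd₁]
    apply auxHcv_self
    intro i
    rw [add_comm (t - 1) 1]
    exact ((isHomogeneous_X k _).mul (auxHcv_hom _ _ i)).sub ((isHomogeneous_X k _).mul (auxHcv_hom _ _ i))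
  let v : κ → MvPolynomial (Fin 3) k := ∑ a, (X a : MvPolynomial (Fin 3) k) • d₀ a
  have hv : ∀ i, (v i).IsHomogeneous t := fun i => by
    simp only [v, Finset.sum_apply, Pi.smul_apply, smul_eq_mul]
    apply IsHomogeneous.sum
    intro a _
    have := (isHomogeneous_X k a).mul (auxHcv_hom (t - 1) (d₁ a) i)
    rwa [show 1 + (t - 1) = t by omega] at this
  have hDv : D v = 0 := by
    simp only [v, map_sum, map_smul, hd₀]
    exact aux_sum_cross y
  -- the core lemma
  have core : ∀ (y : Fin 3 → ι → MvPolynomial (Fin 3) k) (r : ι → MvPolynomial (Fin 3) k)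
      (d : Fin 3 → κ → MvPolynomial (Fin 3) k), (∀ a, G (y a) = X a * G r) →
      (∀ a, D (d a) = (X (a + 1) : MvPolynomial (Fin 3) k) • y (a + 2) -
        (X (a + 2) : MvPolynomial (Fin 3) k) • y (a + 1)) →
      ∃ n : Fin 3 → κ → MvPolynomial (Fin 3) k, (∀ a, D (n a) = 0) ∧
        ∑ a, (X a : MvPolynomial (Fin 3) k) • d a = ∑ a, (X a : MvPolynomial (Fin 3) k) • n a := by
    intro y r d hy hd
    choose l hl using fun a => (hex (y a - (X a : MvPolynomial (Fin 3) k) • r)).1 (by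
      simp [hy])
    refine ⟨fun a => d a - ((X (a + 1) : MvPolynomial (Fin 3) k) • l (a + 2) -
        (X (a + 2) : MvPolynomial (Fin 3) k) • l (a + 1)), fun a => ?_, ?_⟩
    · simp only [map_sub, map_smul, ← hl, hd]
      module
    · simp only [smul_sub _ (d _), Finset.sum_sub_distrib]
      rw [aux_sum_cross, sub_zero]
  refine ⟨v, hv, ?_, fun d => ⟨?_, ?_⟩⟩
  · intro hv0
    obtain ⟨l, hl⟩ := aux_K2v d₀ hv0
    obtain ⟨r, hr⟩ := aux_K1v (fun a => y a - D (l a)) (fun a => by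
      have := hd₀ a
      rw [hl a, map_sub, map_smul, map_smul] at this
      simp only [smul_sub]
      rw [sub_eq_sub_iff_sub_eq_sub, this])
    apply H.hxJ
    rw [hGJ]
    refine ⟨r, ?_⟩
    have h1 := congrArg G (hr 0)
    rw [map_sub, hGD, sub_zero, hy, map_smul, smul_eq_mul] at h1
    exact mul_left_cancel₀ (X_ne_zero _) h1
  · intro hd
    have key : ∀ n (d : κ → MvPolynomial (Fin 3) k), (∀ i, (d i).IsHomogeneous n) → D d = 0 →
        d ∈ Submodule.span (MvPolynomial (Fin 3) k) {v} := by
      intro n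
      induction n with
      | zero => intro d hd h; rw [h0 d hd h]; exact Submodule.zero_mem _
      | succ n ih =>
        intro d hdn hd
        obtain ⟨e, he1, he2⟩ := aux_split_v hdn
        obtain ⟨p, hp⟩ := aux_K2v (fun a => D (e a)) (by
          rw [he2, map_sum] at hd
          simpa using hd)
        obtain ⟨w, hw⟩ := aux_K1c (fun a => G (p a)) (fun a => by
          have := hGD (e a)
          rw [hp a, map_sub, map_smul, map_smul, sub_eq_zero] at this
          exact this)
        obtain ⟨j, hj, c, hc⟩ := H.hsoc w (fun a => by rw [← hw a]; exact (hGJ _).2 ⟨_, rfl⟩)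
        obtain ⟨r, rfl⟩ := (hGJ _).1 hj
        obtain ⟨m, hm1, hm2⟩ := core (fun a => p a - c • y a) r (fun a => e a - c • d₀ a)
          (fun a => by
            rw [map_sub, hw a, hc, map_smul, hy, smul_eq_mul]; ring)
          (fun a => by
            simp only [map_sub, map_smul, hd₀, hp a]
            module)
        have hdd : d = c • v + ∑ a, (X a : MvPolynomial (Fin 3) k) • m a := by
          rw [← hm2, he2]
          simp only [v, smul_sub, Finset.sum_sub_distrib, Finset.smul_sum]
          rw [add_comm]
          simp only [smul_comm c]
          rw [sub_add_cancel]
        rw [← auxHcv_self hdn, hdd, auxHcv_add, auxHcv_sum_X]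
        refine Submodule.add_mem _ ?_ (Submodule.sum_mem _ fun a _ => Submodule.smul_mem _ _
          (ih _ (auxHcv_hom _ _) (by rw [← hD, hm1 a]; funext i; simp [auxHcv])))
        rw [Submodule.mem_span_singleton]
        refine ⟨if t ≤ n + 1 then homogeneousComponent (n + 1 - t) c else 0, ?_⟩
        funext i
        simp only [auxHcv, Pi.smul_apply, smul_eq_mul, aux_hc_mul_right (hv i)]
        split_ifs <;> simp
    have : d ∈ Submodule.span (MvPolynomial (Fin 3) k) {v} := by
      refine aux_mem_of_comp _ d fun n => key n _ (fun i => homogeneousComponent_isHomogeneous _ _) ?_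
      have := hD n d
      rw [hd] at this
      rw [show (fun i => homogeneousComponent n (d i)) = auxHcv n d from rfl, ← this]
      funext i; simp [auxHcv]
    rw [Submodule.mem_span_singleton] at this
    obtain ⟨r, hr⟩ := this
    exact ⟨r, hr.symm⟩
  · rintro ⟨r, rfl⟩
    rw [map_smul, hDv, smul_zero]

end Resolution

section Dimension

theorem aux_finrank_hom (k : Type*) [Field k] (n : ℕ) :
    Module.finrank k (homogeneousSubmodule (Fin 3) k n) = (n + 2).choose 2 := by
  classical
  have hs : {d : Fin 3 →₀ ℕ | d.degree = n} =
      ((Finset.univ : Finset (Fin 3)).finsuppAntidiag n : Set (Fin 3 →₀ ℕ)) := by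
    ext d
    simp [Finset.mem_finsuppAntidiag, Finsupp.degree_eq_sum]
  have e := Finset.card_finsuppAntidiag_nat_eq_choose (s := (Finset.univ : Finset (Fin 3))) n
  have b := basisRestrictSupport k {d : Fin 3 →₀ ℕ | d.degree = n}
  rw [homogeneousSubmodule_eq_finsupp_supported]
  have h1 := Module.finrank_eq_nat_card_basis b
  rw [hs, Nat.card_eq_card_toFinset, Finset.toFinset_coe, e] at h1
  rw [hs]
  refine h1.trans ?_
  rw [Finset.card_univ, Fintype.card_fin, show 3 + n - 1 = n + 2 by omega]
  exact (Nat.choose_symm_add (a := n) (b := 2))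

variable {k : Type*} [Field k] {J : Ideal (MvPolynomial (Fin 3) k)} {s t : ℕ}

instance aux_fd (n : ℕ) : FiniteDimensional k (homogeneousSubmodule (Fin 3) k n) :=
  Module.Finite.iff_fg.2 (homogeneousSubmodule_fg (Fin 3) k n)

/-- The degree `n` part of `J`. -/
noncomputable def auxJ (J : Ideal (MvPolynomial (Fin 3) k)) (n : ℕ) : Submodule k (MvPolynomial (Fin 3) k) :=
  J.restrictScalars k ⊓ homogeneousSubmodule (Fin 3) k n

theorem aux_mem_pow (n : ℕ) (f : MvPolynomial (Fin 3) k) :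
    f ∈ qIdeal k 3 ^ n ↔ ∀ m, m < n → homogeneousComponent m f = 0 := by
  rw [show qIdeal k 3 = idealOfVars (Fin 3) k from rfl, mem_pow_idealOfVars_iff']
  constructor
  · intro h m hm
    ext d
    rw [coeff_homogeneousComponent, coeff_zero]
    split_ifs with hd
    · exact h d (by omega)
    · rfl
  · intro h d hd
    have := congrArg (coeff d) (h _ hd)
    rwa [coeff_homogeneousComponent, if_pos rfl, coeff_zero] at this

theorem aux_hom_mem_pow {n m : ℕ} (h : n ≤ m) {f : MvPolynomial (Fin 3) k} (hf : f.IsHomogeneous m) :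
    f ∈ qIdeal k 3 ^ n := by
  rw [aux_mem_pow]
  intro i hi
  rw [homogeneousComponent_of_mem hf, if_neg (by omega)]

theorem aux_hilb (hJ : ∀ f ∈ J, ∀ n, homogeneousComponent n f ∈ J) (n : ℕ) :
    hilb k 3 J n + Module.finrank k (auxJ J n) = (n + 2).choose 2 := by
  let I := qIdeal k 3 ^ (n + 1) ⊔ J
  let E := homogeneousSubmodule (Fin 3) k n
  let L : E →ₗ[k] (MvPolynomial (Fin 3) k ⧸ I) := (Ideal.Quotient.mkₐ k I).toLinearMap ∘ₗ E.subtype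
  have hI : ∀ f ∈ I, homogeneousComponent n f ∈ J := by
    intro f hf
    obtain ⟨a, ha, b, hb, rfl⟩ := Submodule.mem_sup.1 hf
    rw [map_add, (aux_mem_pow _ _).1 ha n (by omega), zero_add]
    exact hJ b hb n
  have hker : LinearMap.ker L = (auxJ J n).comap E.subtype := by
    ext ⟨f, hf⟩
    have : L ⟨f, hf⟩ = Ideal.Quotient.mk I f := rfl
    rw [LinearMap.mem_ker, this, Ideal.Quotient.eq_zero_iff_mem, Submodule.mem_comap]
    constructor
    · intro h
      refine ⟨?_, hf⟩
      have := hI f h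
      rwa [homogeneousComponent_eq_self hf] at this
    · intro h
      exact Submodule.mem_sup_right h.1
  have hrange : LinearMap.range L =
      (((qIdeal k 3 ^ n ⊔ J).map (Ideal.Quotient.mk I)).restrictScalars k) := by
    apply le_antisymm
    · rintro _ ⟨⟨f, hf⟩, rfl⟩
      exact Ideal.mem_map_of_mem _ (Submodule.mem_sup_left (aux_hom_mem_pow le_rfl hf))
    · intro x hx
      rw [Submodule.restrictScalars_mem, Ideal.mem_map_iff_of_surjective _ Ideal.Quotient.mk_surjective] at hx
      obtain ⟨f, hf, rfl⟩ := hx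
      obtain ⟨a, ha, b, hb, rfl⟩ := Submodule.mem_sup.1 hf
      refine ⟨⟨homogeneousComponent n a, homogeneousComponent_isHomogeneous _ _⟩, ?_⟩
      change Ideal.Quotient.mk I (homogeneousComponent n a) = Ideal.Quotient.mk I (a + b)
      rw [Ideal.Quotient.eq, ← sub_sub]
      refine I.sub_mem (Submodule.mem_sup_left ?_) (Submodule.mem_sup_right hb)
      rw [aux_mem_pow]
      intro m hm
      rw [map_sub, homogeneousComponent_of_mem (homogeneousComponent_isHomogeneous n a)]
      split_ifs with h
      · rw [h, sub_self]
      · rw [(aux_mem_pow _ _).1 ha m (by omega), sub_zero]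
  have h1 := LinearMap.finrank_range_add_finrank_ker L
  rw [hrange, hker, aux_finrank_hom, (Submodule.comapSubtypeEquivOfLe (p := auxJ J n) (q := E) inf_le_right).finrank_eq] at h1
  exact h1

theorem aux_J_pos {n : ℕ} {f : MvPolynomial (Fin 3) k} (hf : f ∈ auxJ J n) (h : f ≠ 0) :
    0 < Module.finrank k (auxJ J n) := by
  have : FiniteDimensional k (auxJ J n) := Submodule.finiteDimensional_of_le
    (inf_le_right : auxJ J n ≤ homogeneousSubmodule (Fin 3) k n)
  rw [Module.finrank_pos_iff_exists_ne_zero]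
  exact ⟨⟨f, hf⟩, fun h' => h (congrArg Subtype.val h')⟩

theorem aux_ctx (hhom : IsHomogeneousIdeal k 3 J) (hq2 : J ≤ qIdeal k 3 ^ 2) (hse : Even s)
    (hsoc : SocDeg k 3 J s) (hini : IniDeg k 3 J t) (hgor : HasTypeOne k 3 J)
    (hcomp : CompressedGor k 3 J s) :
    ∃ x₀, AuxCtx k J s t x₀ ∧ Module.finrank k (auxJ J t) = 2 * t + 1 ∧
      Module.finrank k (auxJ J (t + 1)) = 4 * t + 2 := by
  have hJ : ∀ f ∈ J, ∀ n, homogeneousComponent n f ∈ J := by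
    obtain ⟨S, hS, rfl⟩ := hhom
    let _ := MvPolynomial.gradedAlgebra (σ := Fin 3) (R := k)
    intro f hf n
    refine homogeneousComponent_mem_of_mem (Ideal.homogeneous_span _ S ?_) hf n
    intro x hx
    obtain ⟨n, hn⟩ := hS x hx
    exact ⟨n, hn⟩
  have hdim := aux_hilb hJ
  have hlow : ∀ n, n < t → ∀ f ∈ J, f.IsHomogeneous n → f = 0 := by
    intro n hn f hf hfn
    have := (aux_mem_pow _ _).1 (hini.1 hf) n hn
    rwa [homogeneousComponent_eq_self hfn] at this
  obtain ⟨ft, hft, hft0⟩ : ∃ f ∈ auxJ J t, f ≠ 0 := by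
    obtain ⟨f, hf, hft⟩ := SetLike.not_le_iff_exists.1 hini.2
    refine ⟨homogeneousComponent t f, ⟨hJ f hf t, homogeneousComponent_isHomogeneous _ _⟩, fun h => hft ?_⟩
    rw [aux_mem_pow]
    intro m hm
    rcases Nat.lt_succ_iff_lt_or_eq.1 hm with h1 | rfl
    · exact (aux_mem_pow _ _).1 (hini.1 hf) m h1
    · exact h
  have ht2 : 2 ≤ t := by
    by_contra hlt
    apply hft0
    have := (aux_mem_pow _ _).1 (hq2 hft.1) t (by omega)
    rwa [homogeneousComponent_eq_self hft.2] at this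
  have htpos := aux_J_pos hft hft0
  obtain ⟨m, hm⟩ := hse
  have hh : ∀ n, min ((n + 2).choose 2) (if n ≤ s then (s - n + 2).choose 2 else 0) +
      Module.finrank k (auxJ J n) = (n + 2).choose 2 := by
    intro n
    have := hdim n
    rw [hcomp n] at this
    unfold hQat hQ at this
    simpa [add_comm] using this
  have hmt : m < t := by
    by_contra hle
    have h1 := hh t
    rw [if_pos (by omega), min_eq_left (Nat.choose_le_choose 2 (by omega))] at h1
    omega
  have htm : t ≤ m + 1 := by
    by_contra hlt
    have h1 := hh (m + 1)
    have h0 : auxJ J (m + 1) = ⊥ := by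
      rw [eq_bot_iff]
      intro f hf
      exact hlow (m + 1) (by omega) f hf.1 hf.2
    rw [h0, finrank_bot, add_zero] at h1
    have h2 := min_le_right ((m + 1 + 2).choose 2) (if m + 1 ≤ s then (s - (m + 1) + 2).choose 2 else 0)
    rw [h1] at h2
    split_ifs at h2 with h3
    · have h4 : (s - (m + 1) + 2).choose 2 ≤ (m + 2).choose 2 := Nat.choose_le_choose 2 (by omega)
      have h5 : (m + 1 + 2).choose 2 = (m + 2) + (m + 2).choose 2 := by
        rw [Nat.choose_succ_succ' (m + 2) 1, Nat.choose_one_right]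
      omega
    · have := Nat.choose_pos (show 2 ≤ m + 1 + 2 by omega)
      omega
  obtain ⟨u, rfl⟩ : ∃ u, t = u + 2 := ⟨t - 2, by omega⟩
  have hst : s + 2 = 2 * (u + 2) := by omega
  have c0 : (u + 1).choose 2 + (u + 1) = (u + 2).choose 2 := by
    rw [Nat.choose_succ_succ' (u + 1) 1, Nat.choose_one_right, add_comm]
  have c1 : (u + 2).choose 2 + (u + 2) = (u + 2 + 1).choose 2 := by
    rw [Nat.choose_succ_succ' (u + 2) 1, Nat.choose_one_right, add_comm]
  have c2 : (u + 2 + 1).choose 2 + (u + 3) = (u + 2 + 2).choose 2 := by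
    rw [Nat.choose_succ_succ' (u + 3) 1, Nat.choose_one_right, add_comm]
  have c3 : (u + 2 + 2).choose 2 + (u + 4) = (u + 2 + 1 + 2).choose 2 := by
    rw [Nat.choose_succ_succ' (u + 4) 1, Nat.choose_one_right, add_comm]
  have d1 : Module.finrank k (auxJ J (u + 2)) = 2 * (u + 2) + 1 := by
    have h1 := hh (u + 2)
    rw [if_pos (by omega), show s - (u + 2) + 2 = u + 2 by omega,
      min_eq_right (Nat.choose_le_choose 2 (by omega))] at h1
    omega
  have d2 : Module.finrank k (auxJ J (u + 2 + 1)) = 4 * (u + 2) + 2 := by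
    have h1 := hh (u + 2 + 1)
    have h2 : (if u + 2 + 1 ≤ s then (s - (u + 2 + 1) + 2).choose 2 else 0) = (u + 1).choose 2 := by
      split_ifs with h3
      · congr 1; omega
      · obtain rfl : u = 0 := by omega
        simp
    rw [h2, min_eq_right (Nat.choose_le_choose 2 (by omega))] at h1
    omega
  have htop : ∀ n, s < n → ∀ f : MvPolynomial (Fin 3) k, f.IsHomogeneous n → f ∈ J :=
    fun n hn f hf => hsoc.2 (aux_hom_mem_pow hn hf)
  -- the socle generator
  obtain ⟨x₀, hx₀, hx₀J⟩ : ∃ x : MvPolynomial (Fin 3) k, x.IsHomogeneous s ∧ x ∉ J := by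
    obtain ⟨f, hf, hfJ⟩ := SetLike.not_le_iff_exists.1 hsoc.1
    refine ⟨homogeneousComponent s f, homogeneousComponent_isHomogeneous _ _, fun h => hfJ ?_⟩
    rw [← sum_homogeneousComponent f]
    refine J.sum_mem fun n _ => ?_
    rcases lt_trichotomy n s with h1 | rfl | h1
    · rw [(aux_mem_pow _ _).1 hf n h1]; exact J.zero_mem
    · exact h
    · exact htop n h1 _ (homogeneousComponent_isHomogeneous _ _)
  have hxs : ∀ a, X a * x₀ ∈ J := fun a =>
    htop (1 + s) (by omega) _ ((isHomogeneous_X k a).mul hx₀)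
  have hcol : ∀ f, (∀ a, X a * f ∈ J) → f ∈ J.colon (qIdeal k 3 : Set (MvPolynomial (Fin 3) k)) := by
    intro f hf
    rw [qIdeal, Ideal.colon_span, Submodule.mem_colon]
    rintro _ ⟨a, rfl⟩
    rw [smul_eq_mul, mul_comm]
    exact hf a
  obtain ⟨x, hxJ, hxc⟩ := hgor
  have hxq : ∀ c ∈ qIdeal k 3, c * x ∈ J := by
    have : x ∈ J.colon (qIdeal k 3 : Set (MvPolynomial (Fin 3) k)) := by
      rw [hxc]; exact Submodule.mem_sup_right (Ideal.mem_span_singleton_self x)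
    rw [Submodule.mem_colon] at this
    intro c hc
    rw [mul_comm]
    exact this c hc
  have hrep : ∀ f, (∀ a, X a * f ∈ J) → ∃ j ∈ J, ∃ c : k, f = j + C c * x := by
    intro f hf
    have := hcol f hf
    rw [hxc] at this
    obtain ⟨j, hj, b, hb, rfl⟩ := Submodule.mem_sup.1 this
    obtain ⟨c, rfl⟩ := Ideal.mem_span_singleton'.1 hb
    refine ⟨j + (c - C (coeff 0 c)) * x, J.add_mem hj (hxq _ ?_), coeff 0 c, by ring⟩
    rw [← pow_one (qIdeal k 3), aux_mem_pow]
    intro m hm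
    obtain rfl : m = 0 := by omega
    simp [homogeneousComponent_zero]
  refine ⟨x₀, ⟨hJ, hlow, htop, hx₀, hx₀J, hxs, ?_, hst, ht2⟩, d1, d2⟩
  obtain ⟨j₀, hj₀, c₀, e₀⟩ := hrep x₀ hxs
  have hc₀ : c₀ ≠ 0 := by
    rintro rfl
    apply hx₀J
    rw [e₀]; simpa using hj₀
  intro f hf
  obtain ⟨j, hj, c, e⟩ := hrep f hf
  refine ⟨j - C (c * c₀⁻¹) * j₀, J.sub_mem hj (J.mul_mem_left _ hj₀), C (c * c₀⁻¹), ?_⟩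
  have hC : C c₀⁻¹ * C c₀ = (1 : MvPolynomial (Fin 3) k) := by
    rw [← C_mul, inv_mul_cancel₀ hc₀, C_1]
  rw [e₀, e, C_mul]
  linear_combination (-C c * x) * hC

end Dimension

section Final

theorem aux_basis {k V : Type*} [Field k] [AddCommGroup V] [Module k V] [FiniteDimensional k V]
    {N : ℕ} (W : Submodule k V) (h : Module.finrank k W = N) :
    ∃ b : Fin N → V, (∀ j, b j ∈ W) ∧ (∀ w ∈ W, ∃ a : Fin N → k, w = ∑ j, a j • b j) ∧
      (∀ a : Fin N → k, ∑ j, a j • b j = 0 → ∀ j, a j = 0) := by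
  let b := Module.finBasisOfFinrankEq k W h
  have hsum : ∀ a : Fin N → k, ((∑ j, a j • b j : W) : V) = ∑ j, a j • (b j : V) := fun a => by
    simp
  refine ⟨fun j => b j, fun j => (b j).2, fun w hw => ⟨b.repr ⟨w, hw⟩, ?_⟩, fun a ha => ?_⟩
  · rw [← hsum, b.sum_repr]
  · rw [← hsum] at ha
    exact Fintype.linearIndependent_iff.1 b.linearIndependent _ (Subtype.ext ha)

theorem aux_lin {k : Type*} [Field k] {J : Ideal (MvPolynomial (Fin 3) k)} {t N : ℕ}
    (hN : N = 2 * t + 1)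
    (d2 : Module.finrank k (auxJ J (t + 1)) = 4 * t + 2)
    (G : (Fin N → MvPolynomial (Fin 3) k) →ₗ[MvPolynomial (Fin 3) k] MvPolynomial (Fin 3) k)
    (hG : ∀ n c, homogeneousComponent (n + t) (G c) = G (auxHcv n c))
    (hGJ : ∀ f, f ∈ J ↔ ∃ c, f = G c) :
    ∃ B : Fin N → Fin N → MvPolynomial (Fin 3) k,
      (∀ j i, (B j i).IsHomogeneous 1) ∧ (∀ j, G (B j) = 0) ∧
      (∀ c, (∀ i, (c i).IsHomogeneous 1) → G c = 0 → ∃ a : Fin N → k, c = ∑ j, a j • B j) ∧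
      (∀ a : Fin N → k, ∑ j, a j • B j = 0 → ∀ j, a j = 0) := by
  obtain ⟨ev, hev⟩ : ∃ ev : (Fin N → homogeneousSubmodule (Fin 3) k 1) →ₗ[k]
      (Fin N → MvPolynomial (Fin 3) k), ∀ c i, ev c i = (c i : MvPolynomial (Fin 3) k) :=
    ⟨LinearMap.pi fun i => (homogeneousSubmodule (Fin 3) k 1).subtype ∘ₗ LinearMap.proj i,
      fun c i => rfl⟩
  obtain ⟨L, hL⟩ : ∃ L : (Fin N → homogeneousSubmodule (Fin 3) k 1) →ₗ[k]
      MvPolynomial (Fin 3) k, ∀ c, L c = G (ev c) :=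
    ⟨(G.restrictScalars k) ∘ₗ ev, fun c => rfl⟩
  have hev1 : ∀ c, (∀ i, (c i).IsHomogeneous 1) → ∃ c', ev c' = c := fun c hc =>
    ⟨fun i => ⟨c i, hc i⟩, funext fun i => hev _ i⟩
  have hev2 : ∀ c i, (ev c i).IsHomogeneous 1 := fun c i => by rw [hev]; exact (c i).2
  have hev3 : ∀ c, ev c = 0 → c = 0 := fun c h => by
    funext i
    apply Subtype.ext
    rw [← hev, h]; rfl
  have hrange : LinearMap.range L = auxJ J (t + 1) := by
    apply le_antisymm
    · rintro _ ⟨c, rfl⟩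
      refine ⟨(hGJ _).2 ⟨_, hL c⟩, ?_⟩
      have h1 : auxHcv 1 (ev c) = ev c := auxHcv_self fun i => hev2 c i
      rw [hL, ← h1, ← hG, add_comm]
      exact homogeneousComponent_isHomogeneous _ _
    · rintro f ⟨hf1, hf2⟩
      obtain ⟨c, rfl⟩ := (hGJ f).1 hf1
      obtain ⟨c', hc'⟩ := hev1 (auxHcv 1 c) (auxHcv_hom 1 c)
      refine ⟨c', ?_⟩
      rw [hL, hc', ← hG, add_comm]
      exact homogeneousComponent_eq_self hf2
  have hfd : FiniteDimensional k (Fin N → homogeneousSubmodule (Fin 3) k 1) := inferInstance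
  have hker : Module.finrank k (LinearMap.ker L) = N := by
    have h1 := LinearMap.finrank_range_add_finrank_ker L
    have h3 : (1 + 2).choose 2 = 3 := rfl
    rw [hrange, d2, Module.finrank_pi_fintype] at h1
    simp only [aux_finrank_hom, Finset.sum_const, Finset.card_univ, Fintype.card_fin,
      smul_eq_mul, h3] at h1
    omega
  obtain ⟨b, hb1, hb2, hb3⟩ := aux_basis (LinearMap.ker L) hker
  have hsum : ∀ a : Fin N → k, ev (∑ j, a j • b j) = ∑ j, a j • ev (b j) := by
    intro a
    rw [map_sum]
    exact Finset.sum_congr rfl fun j _ => map_smul ev _ _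
  refine ⟨fun j => ev (b j), fun j i => hev2 _ i, fun j => ?_, fun c hc hc0 => ?_, fun a ha => ?_⟩
  · rw [← hL]; exact LinearMap.mem_ker.1 (hb1 j)
  · obtain ⟨c', rfl⟩ := hev1 c hc
    have hk : c' ∈ LinearMap.ker L := by rw [LinearMap.mem_ker, hL]; exact hc0
    obtain ⟨a, rfl⟩ := hb2 c' hk
    exact ⟨a, hsum a⟩
  · rw [← hsum] at ha
    exact hb3 a (hev3 _ ha)

theorem aux_final {k : Type*} [Field k] {J : Ideal (MvPolynomial (Fin 3) k)} {s t : ℕ}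
    {x₀ : MvPolynomial (Fin 3) k} (H : AuxCtx k J s t x₀)
    (d1 : Module.finrank k (auxJ J t) = 2 * t + 1)
    (d2 : Module.finrank k (auxJ J (t + 1)) = 4 * t + 2) :
    ∃ (g : Fin (2 * t + 1) → MvPolynomial (Fin 3) k)
      (M : Matrix (Fin (2 * t + 1)) (Fin (2 * t + 1)) (MvPolynomial (Fin 3) k))
      (v : Fin (2 * t + 1) → MvPolynomial (Fin 3) k),
      (∀ i, (g i).IsHomogeneous t) ∧
      J = Ideal.span (Set.range g) ∧
      (∀ i j, (M i j).IsHomogeneous 1) ∧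
      (∀ i, (v i).IsHomogeneous (s + 2 - t)) ∧
      (∀ c : Fin (2 * t + 1) → MvPolynomial (Fin 3) k,
        (∑ i, c i * g i = 0) ↔ ∃ d, c = M.mulVec d) ∧
      (∀ d : Fin (2 * t + 1) → MvPolynomial (Fin 3) k,
        M.mulVec d = 0 ↔ ∃ r : MvPolynomial (Fin 3) k, d = r • v) ∧
      (∀ r : MvPolynomial (Fin 3) k, r • v = 0 → r = 0) := by
  have hC0 : ∀ {f : MvPolynomial (Fin 3) k}, f.IsHomogeneous 0 → f = C (coeff 0 f) := by
    intro f hf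
    conv_lhs => rw [← homogeneousComponent_eq_self hf, homogeneousComponent_zero]
  have : FiniteDimensional k (auxJ J t) := Submodule.finiteDimensional_of_le
    (inf_le_right : auxJ J t ≤ homogeneousSubmodule (Fin 3) k t)
  obtain ⟨gb⟩ : Nonempty (Module.Basis (Fin (2 * t + 1)) k (auxJ J t)) :=
    ⟨Module.finBasisOfFinrankEq k (auxJ J t) d1⟩
  let g : Fin (2 * t + 1) → MvPolynomial (Fin 3) k := fun i => (gb i : MvPolynomial (Fin 3) k)
  have hgh : ∀ i, (g i).IsHomogeneous t := fun i => (gb i).2.2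
  have hgJ : ∀ i, g i ∈ J := fun i => (gb i).2.1
  have hgspan : ∀ f ∈ J, f.IsHomogeneous t → f ∈ Submodule.span k (Set.range g) := by
    intro f hf hft
    have h1 := congrArg Subtype.val (gb.sum_repr ⟨f, hf, hft⟩)
    rw [← show _ = f from h1, Submodule.coe_sum]
    exact Submodule.sum_mem _ fun i _ => Submodule.smul_mem _ _ (Submodule.subset_span ⟨i, rfl⟩)
  have hgind : LinearIndependent k g := gb.linearIndependent.map' (auxJ J t).subtype
    (Submodule.ker_subtype _)
  have hspan := aux_gen H g hgJ hgspan
  obtain ⟨G, hGdef⟩ : ∃ G : (Fin (2 * t + 1) → MvPolynomial (Fin 3) k) →ₗ[MvPolynomial (Fin 3) k]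
      MvPolynomial (Fin 3) k, ∀ c, G c = ∑ i, c i * g i :=
    ⟨Fintype.linearCombination (MvPolynomial (Fin 3) k) g, fun c => by
      simp [Fintype.linearCombination_apply]⟩
  have hG : ∀ n c, homogeneousComponent (n + t) (G c) = G (auxHcv n c) := by
    intro n c
    rw [hGdef, hGdef, map_sum]
    refine Finset.sum_congr rfl fun i _ => ?_
    rw [aux_hc_mul_right (hgh i), if_pos (by omega), Nat.add_sub_cancel]
    rfl
  have hGJ : ∀ f, f ∈ J ↔ ∃ c, f = G c := by
    intro f
    rw [hspan, Ideal.mem_span_range_iff_exists_fun]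
    simp only [hGdef, eq_comm]
  have hG0 : ∀ c, (∀ i, (c i).IsHomogeneous 0) → G c = 0 → c = 0 := by
    intro c hc h
    rw [Fintype.linearIndependent_iff] at hgind
    have h1 := hgind (fun i => coeff 0 (c i)) (by
      rw [← h, hGdef]
      refine Finset.sum_congr rfl fun i _ => ?_
      rw [smul_eq_C_mul, ← hC0 (hc i)])
    funext i
    rw [hC0 (hc i), h1 i]; simp
  obtain ⟨B, hB1, hB2, hB3, hB4⟩ := aux_lin rfl d2 G hG hGJ
  obtain ⟨M, hM⟩ : ∃ M : Matrix (Fin (2 * t + 1)) (Fin (2 * t + 1)) (MvPolynomial (Fin 3) k),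
      ∀ i j, M i j = B j i := ⟨fun i j => B j i, fun _ _ => rfl⟩
  have hMh : ∀ i j, (M i j).IsHomogeneous 1 := fun i j => by rw [hM]; exact hB1 j i
  have hDdef : ∀ d i, M.mulVecLin d i = ∑ j, d j * M i j := fun d i => by
    simp [Matrix.mulVec, dotProduct, mul_comm]
  have hDsum : ∀ d, M.mulVecLin d = ∑ j, d j • B j := fun d => by
    funext i
    rw [hDdef, Finset.sum_apply]
    exact Finset.sum_congr rfl fun j _ => by rw [hM]; rfl
  have hGD : ∀ d, G (M.mulVecLin d) = 0 := by
    intro d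
    rw [hDsum, map_sum]
    refine Finset.sum_eq_zero fun j _ => ?_
    rw [map_smul, hB2, smul_zero]
  have hDc : ∀ d : Fin (2 * t + 1) → k, M.mulVecLin (fun j => C (d j)) = ∑ j, d j • B j := by
    intro d
    rw [hDsum]
    refine Finset.sum_congr rfl fun j _ => ?_
    funext i
    rw [Pi.smul_apply, Pi.smul_apply, smul_eq_C_mul, smul_eq_mul]
  have hex : ∀ c, G c = 0 ↔ ∃ d, c = M.mulVecLin d := by
    intro c
    constructor
    · intro hc
      have := aux_syz H G hG hGJ (LinearMap.range M.mulVecLin) hG0 (fun c hc1 hc => by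
        obtain ⟨a, rfl⟩ := hB3 c hc1 hc
        exact ⟨fun j => C (a j), hDc a⟩) c hc
      obtain ⟨d, hd⟩ := this
      exact ⟨d, hd.symm⟩
    · rintro ⟨d, rfl⟩
      exact hGD d
  have hD : ∀ n c, auxHcv (n + 1) (M.mulVecLin c) = M.mulVecLin (auxHcv n c) := by
    intro n c
    funext i
    rw [hDdef]
    simp only [auxHcv]
    rw [hDdef, map_sum]
    refine Finset.sum_congr rfl fun j _ => ?_
    rw [aux_hc_mul_right (hMh i j), if_pos (by omega), Nat.add_sub_cancel]
  have hD0 : ∀ d, (∀ i, (d i).IsHomogeneous 0) → M.mulVecLin d = 0 → d = 0 := by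
    intro d hd h
    have h1 : d = fun j => C (coeff 0 (d j)) := funext fun j => hC0 (hd j)
    rw [h1, hDc] at h
    have h3 := hB4 _ h
    rw [h1]
    funext j
    simp [h3 j]
  obtain ⟨v, hv1, hv2, hv3⟩ := aux_ker H G hG hGJ M.mulVecLin hD hex hD0
  refine ⟨g, M, v, hgh, hspan, hMh, ?_, ?_, ?_, ?_⟩
  · intro i
    rw [show s + 2 - t = t by have := H.hst; omega]
    exact hv1 i
  · intro c
    rw [← hGdef]
    exact hex c
  · intro d
    exact hv3 d
  · intro r hr
    rcases smul_eq_zero.1 hr with h | h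
    · exact h
    · exact absurd h hv2

end Final

/-- Let `Q = k[[x,y,z]]` (graded setting) and `J ⊆ q^2` a
`q`-primary homogeneous ideal with `S = Q/J` compressed Gorenstein of even
socle degree `s` and initial degree `t`.  Then the minimal graded free
resolution of `S` over `Q` has the form
`Q ← Q^{2t+1}(−t) ← Q^{2t+1}(−t−1) ← Q(−s−3) ← 0`:
`J` is generated by `2t+1` forms of degree `t` whose syzygy module is generated
by the columns of a `(2t+1) × (2t+1)` matrix of linear forms, whose kernel in
turn is freely spanned by a single vector of forms of degree `s+2−t`. -/
theorem stmt15 (k : Type*) [Field k]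
    (J : Ideal (MvPolynomial (Fin 3) k))
    (hhom : IsHomogeneousIdeal k 3 J)
    (hp : J.IsPrimary) (hr : J.radical = qIdeal k 3)
    (hq2 : J ≤ qIdeal k 3 ^ 2)
    (s t : ℕ) (hse : Even s)
    (hsoc : SocDeg k 3 J s) (hini : IniDeg k 3 J t)
    (hgor : HasTypeOne k 3 J)
    (hcomp : CompressedGor k 3 J s) :
    ∃ (g : Fin (2 * t + 1) → MvPolynomial (Fin 3) k)
      (M : Matrix (Fin (2 * t + 1)) (Fin (2 * t + 1)) (MvPolynomial (Fin 3) k))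
      (v : Fin (2 * t + 1) → MvPolynomial (Fin 3) k),
      (∀ i, (g i).IsHomogeneous t) ∧
      J = Ideal.span (Set.range g) ∧
      (∀ i j, (M i j).IsHomogeneous 1) ∧
      (∀ i, (v i).IsHomogeneous (s + 2 - t)) ∧
      (∀ c : Fin (2 * t + 1) → MvPolynomial (Fin 3) k,
        (∑ i, c i * g i = 0) ↔ ∃ d, c = M.mulVec d) ∧
      (∀ d : Fin (2 * t + 1) → MvPolynomial (Fin 3) k,
        M.mulVec d = 0 ↔ ∃ r : MvPolynomial (Fin 3) k, d = r • v) ∧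
      (∀ r : MvPolynomial (Fin 3) k, r • v = 0 → r = 0) := by
  obtain ⟨x₀, H, d1, d2⟩ := aux_ctx hhom hq2 hse hsoc hini hgor hcomp
  exact aux_final H d1 d2
end
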